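/- arXiv:1004.1778 — 2 statements merged into one kernel-verified Lean document; each statement's English description precedes it below -/
import Mathlib

section
/- Fix a real number β. For a Δ-tree T of order n ≥ 2, let R_β(T) = Σ_{uv ∈ E(T)} (deg u · deg v)^β be the general Randić index of T (well defined on isomorphism classes, and all degrees are ≥ 1). Then there exists a real constant r_β such that for every ε > 0, the probability (under the uniform measure on 𝒯_n^Δ) that |R_β(T) − r_β·n| ≤ ε·n tends to 1 as n → ∞. -/
open Filter Topology MeasureTheory

namespace TreePaper

/-- The degree of a vertex `v` in a simple graph on `Fin n`. -/
noncomputable def degr {n : ℕ} (G : SimpleGraph (Fin n)) (v : Fin n) : ℕ :=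
  Nat.card {u : Fin n // G.Adj v u}

/-- A `Δ`-tree of order `n`: a tree on `n` vertices with all degrees at most `Δ`. -/
abbrev DTree (Δ n : ℕ) : Type :=
  {G : SimpleGraph (Fin n) // G.IsTree ∧ ∀ v, degr G v ≤ Δ}

instance treeSetoid (Δ n : ℕ) : Setoid (DTree Δ n) where
  r G H := Nonempty (G.1 ≃g H.1)
  iseqv :=
    ⟨fun G => ⟨SimpleGraph.Iso.refl⟩, fun ⟨e⟩ => ⟨e.symm⟩, fun ⟨e⟩ ⟨f⟩ => ⟨e.trans f⟩⟩

/-- Isomorphism classes of `Δ`-trees of order `n`. -/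
abbrev TClass (Δ n : ℕ) : Type := Quotient (treeSetoid Δ n)

/-- The number of vertices of degree `j` in `G`. -/
noncomputable def vcount {n : ℕ} (j : ℕ) (G : SimpleGraph (Fin n)) : ℕ :=
  Nat.card {v : Fin n // degr G v = j}

/-- The number of vertices of degree `j`, as a random variable on iso classes. -/
noncomputable def Xdeg (Δ n j : ℕ) (c : TClass Δ n) : ℕ :=
  vcount j (Quotient.out c).1

/-- Probability of an event under the uniform measure on iso classes of `Δ`-trees. -/
noncomputable def prob (Δ n : ℕ) (P : TClass Δ n → Prop) : ℝ :=
  (Nat.card {c : TClass Δ n // P c} : ℝ) / (Nat.card (TClass Δ n) : ℝ)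

/-- Expectation under the uniform measure on iso classes of `Δ`-trees. -/
noncomputable def mean (Δ n : ℕ) (f : TClass Δ n → ℝ) : ℝ :=
  (∑ᶠ c : TClass Δ n, f c) / (Nat.card (TClass Δ n) : ℝ)

/-- Variance under the uniform measure on iso classes of `Δ`-trees. -/
noncomputable def variance (Δ n : ℕ) (f : TClass Δ n → ℝ) : ℝ :=
  (∑ᶠ c : TClass Δ n, (f c - mean Δ n f) ^ 2) / (Nat.card (TClass Δ n) : ℝ)

/-- The standard normal distribution function. -/
noncomputable def stdNormalCDF (t : ℝ) : ℝ :=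
  (Real.sqrt (2 * Real.pi))⁻¹ * ∫ s in Set.Iic t, Real.exp (-(s ^ 2) / 2)

end TreePaper

namespace TreePaper

/-- The general Randić index `R_β(G) = Σ_{uv ∈ E(G)} (deg u · deg v)^β` of a graph on `Fin n`. -/
noncomputable def randic {n : ℕ} (β : ℝ) (G : SimpleGraph (Fin n)) : ℝ :=
  ∑ᶠ e : G.edgeSet,
    Sym2.lift ⟨fun u v => ((degr G u : ℝ) * (degr G v : ℝ)) ^ β,
      fun u v => by simp [mul_comm]⟩ (e : Sym2 (Fin n))

/-- The Matula code of an unlabelled rooted tree, from the multiset of the codes of its branches. -/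
noncomputable def code (m : Multiset ℕ) : ℕ := (m.map (Nat.nth Nat.Prime)).prod - 1

/-- The multiset of branches of the unlabelled rooted tree with the given Matula code. -/
noncomputable def ch (c : ℕ) : Multiset ℕ :=
  (((c + 1).primeFactorsList : List ℕ) : Multiset ℕ).map (Nat.count Nat.Prime)

lemma prod_nth_prime_pos (m : Multiset ℕ) : 0 < (m.map (Nat.nth Nat.Prime)).prod := by
  apply Nat.pos_of_ne_zero
  rw [Ne, Multiset.prod_eq_zero_iff, Multiset.mem_map]
  rintro ⟨x, -, hx⟩
  have := Nat.add_two_le_nth_prime x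
  omega

lemma ch_code (m : Multiset ℕ) : ch (code m) = m := by
  have hpos := prod_nth_prime_pos m
  have h1 : code m + 1 = (m.map (Nat.nth Nat.Prime)).prod := by unfold code; omega
  have h2 : (((code m + 1).primeFactorsList : List ℕ) : Multiset ℕ)
      = m.map (Nat.nth Nat.Prime) := by
    induction m using Quotient.inductionOn with
    | h l =>
      simp only [Multiset.quot_mk_to_coe, Multiset.map_coe, Multiset.prod_coe] at h1 ⊢
      refine Multiset.coe_eq_coe.2 (Nat.primeFactorsList_unique h1.symm ?_).symm
      intro p hp
      obtain ⟨x, -, rfl⟩ := List.mem_map.1 hp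
      exact Nat.prime_nth_prime x
  rw [ch, h2, Multiset.map_map]
  conv_rhs => rw [← Multiset.map_id m]
  refine Multiset.map_congr rfl fun x _ => ?_
  exact Nat.count_nth_of_infinite Nat.infinite_setOfPred_prime x

lemma code_ch (c : ℕ) : code (ch c) = c := by
  have h : (ch c).map (Nat.nth Nat.Prime) = (((c + 1).primeFactorsList : List ℕ) : Multiset ℕ) := by
    rw [ch, Multiset.map_map]
    conv_rhs => rw [← Multiset.map_id (((c + 1).primeFactorsList : List ℕ) : Multiset ℕ)]
    refine Multiset.map_congr rfl fun p hp => ?_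
    exact Nat.nth_count (Nat.prime_of_mem_primeFactorsList (Multiset.mem_coe.1 hp))
  rw [code, h, Multiset.prod_coe, Nat.prod_primeFactorsList (by omega)]
  rfl

lemma ch_injective : Function.Injective ch := Function.LeftInverse.injective code_ch

lemma code_injective : Function.Injective code := Function.LeftInverse.injective ch_code

lemma lt_code {m : Multiset ℕ} {x : ℕ} (hx : x ∈ m) : x < code m := by
  have h := Multiset.dvd_prod (Multiset.mem_map_of_mem (Nat.nth Nat.Prime) hx)
  have := Nat.le_of_dvd (prod_nth_prime_pos m) h
  have := Nat.add_two_le_nth_prime x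
  unfold code
  omega

lemma lt_of_mem_ch {c x : ℕ} (hx : x ∈ ch c) : x < c := by
  simpa [code_ch] using lt_code hx

/-- The additive functional on rooted trees with toll function `φ`. -/
noncomputable def fold {M : Type*} [AddCommMonoid M] (φ : ℕ → M) (c : ℕ) : M :=
  φ c + ((ch c).attach.map fun x => fold φ x.1).sum
termination_by c
decreasing_by exact lt_of_mem_ch x.2

lemma fold_eq {M : Type*} [AddCommMonoid M] (φ : ℕ → M) (c : ℕ) :
    fold φ c = φ c + ((ch c).map (fold φ)).sum := by
  rw [fold, Multiset.attach_map_val' (ch c) (fold φ)]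

/-- The number of vertices of a rooted tree. -/
noncomputable def size : ℕ → ℕ := fold fun _ => 1

lemma size_eq (c : ℕ) : size c = 1 + ((ch c).map size).sum := fold_eq _ c

lemma size_pos (c : ℕ) : 0 < size c := by rw [size_eq]; omega

/-- The out-degree of the root. -/
noncomputable def kdeg (c : ℕ) : ℕ := (ch c).card

/-- All out-degrees are less than `d`. -/
inductive Good (d : ℕ) : ℕ → Prop
  | mk (c : ℕ) : kdeg c < d → (∀ x ∈ ch c, Good d x) → Good d c

lemma good_iff {d c : ℕ} : Good d c ↔ kdeg c < d ∧ ∀ x ∈ ch c, Good d x :=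
  ⟨fun ⟨_, h1, h2⟩ => ⟨h1, h2⟩, fun ⟨h1, h2⟩ => ⟨c, h1, h2⟩⟩

/-- The multisets of cardinality `j` with elements in `s`. -/
def msets (s : Finset ℕ) (j : ℕ) : Finset (Multiset ℕ) :=
  (s.sym j).map ⟨fun m => m.1, Subtype.val_injective⟩

lemma mem_msets {s : Finset ℕ} {j : ℕ} {m : Multiset ℕ} :
    m ∈ msets s j ↔ m.card = j ∧ ∀ x ∈ m, x ∈ s := by
  simp only [msets, Finset.mem_map]
  constructor
  · rintro ⟨a, ha, rfl⟩
    exact ⟨a.2, Finset.mem_sym_iff.1 ha⟩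
  · rintro ⟨h1, h2⟩
    exact ⟨⟨m, h1⟩, Finset.mem_sym_iff.2 h2, rfl⟩

/-- The complete homogeneous symmetric polynomials in terms of the power sums `p 1, p 2, …`. -/
noncomputable def homog (p : ℕ → ℝ) : ℕ → ℝ
  | 0 => 1
  | j + 1 => (∑ i : Fin (j + 1), p (i + 1) * homog p (j - i)) / (j + 1)

lemma homog_zero (p : ℕ → ℝ) : homog p 0 = 1 := by rw [homog]

lemma homog_succ (p : ℕ → ℝ) (j : ℕ) :
    homog p (j + 1) = (∑ i ∈ Finset.range (j + 1), p (i + 1) * homog p (j - i)) / (j + 1) := by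
  rw [homog, Finset.sum_range]

lemma sum_msets_count (s : Finset ℕ) (w : ℕ → ℝ) {x : ℕ} (hx : x ∈ s) {i j : ℕ} (hi : i ≤ j) :
    ∑ m ∈ msets s j with i ≤ m.count x, (m.map w).prod
      = w x ^ i * ∑ m ∈ msets s (j - i), (m.map w).prod := by
  rw [Finset.mul_sum]
  symm
  refine Finset.sum_bij (fun m _ => m + Multiset.replicate i x) ?_ ?_ ?_ ?_
  · intro m hm
    obtain ⟨h1, h2⟩ := mem_msets.1 hm
    rw [Finset.mem_filter, mem_msets]
    refine ⟨⟨by simp [h1]; omega, fun y hy => ?_⟩, by simp⟩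
    rcases Multiset.mem_add.1 hy with h | h
    · exact h2 y h
    · rwa [Multiset.eq_of_mem_replicate h]
  · intro a _ b _ h
    exact add_right_cancel h
  · intro m hm
    rw [Finset.mem_filter, mem_msets] at hm
    obtain ⟨⟨h1, h2⟩, h3⟩ := hm
    have hle := Multiset.le_count_iff_replicate_le.1 h3
    refine ⟨m - Multiset.replicate i x, mem_msets.2 ⟨?_, fun y hy => ?_⟩, ?_⟩
    · rw [Multiset.card_sub hle, h1, Multiset.card_replicate]
    · exact h2 y (Multiset.mem_of_le (Multiset.sub_le_self _ _) hy)
    · exact Multiset.sub_add_cancel hle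
  · intro m _
    simp [mul_comm]

/-- Newton's identities for complete homogeneous symmetric polynomials. -/
lemma newton_msets (s : Finset ℕ) (w : ℕ → ℝ) (j : ℕ) :
    ((j : ℝ) + 1) * ∑ m ∈ msets s (j + 1), (m.map w).prod
      = ∑ i ∈ Finset.range (j + 1),
          (∑ x ∈ s, w x ^ (i + 1)) * ∑ m ∈ msets s (j - i), (m.map w).prod := by
  have key : ∀ m ∈ msets s (j + 1), ((j : ℝ) + 1) * (m.map w).prod
      = ∑ i ∈ Finset.range (j + 1), ∑ x ∈ s,
          if i + 1 ≤ m.count x then (m.map w).prod else 0 := by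
    intro m hm
    obtain ⟨h1, h2⟩ := mem_msets.1 hm
    rw [Finset.sum_comm]
    have h3 : ∀ x ∈ s, (∑ i ∈ Finset.range (j + 1),
        if i + 1 ≤ m.count x then (m.map w).prod else 0) = m.count x * (m.map w).prod := by
      intro x _
      have hc : m.count x ≤ j + 1 := h1 ▸ Multiset.count_le_card x m
      rw [← Finset.sum_filter, Finset.sum_const, nsmul_eq_mul]
      congr 2
      rw [show (Finset.range (j + 1)).filter (fun i => i + 1 ≤ m.count x)
        = Finset.range (m.count x) by ext i; simp; omega, Finset.card_range]
    rw [Finset.sum_congr rfl h3, ← Finset.sum_mul, ← Nat.cast_sum,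
      Multiset.sum_count_eq_card h2, h1]
    push_cast; ring
  rw [Finset.mul_sum, Finset.sum_congr rfl key, Finset.sum_comm]
  refine Finset.sum_congr rfl fun i hi => ?_
  rw [Finset.sum_comm, Finset.sum_mul]
  refine Finset.sum_congr rfl fun x hx => ?_
  have hi' := Finset.mem_range.1 hi
  rw [← Finset.sum_filter, sum_msets_count s w hx (by omega)]
  congr 3
  omega

lemma sum_msets_eq_homog (s : Finset ℕ) (w : ℕ → ℝ) (j : ℕ) :
    ∑ m ∈ msets s j, (m.map w).prod = homog (fun i => ∑ x ∈ s, w x ^ i) j := by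
  induction j using Nat.strong_induction_on with
  | _ j ih =>
    cases j with
    | zero =>
      have : msets s 0 = {0} := by
        ext m; rw [mem_msets, Multiset.card_eq_zero, Finset.mem_singleton]
        exact ⟨fun h => h.1, fun h => ⟨h, by simp [h]⟩⟩
      simp [this, homog_zero]
    | succ j =>
      rw [homog_succ, eq_div_iff (by positivity), mul_comm, newton_msets]
      refine Finset.sum_congr rfl fun i hi => ?_
      rw [ih (j - i) (by omega)]

lemma homog_nonneg {p : ℕ → ℝ} (hp : ∀ i, 0 ≤ p i) (j : ℕ) : 0 ≤ homog p j := by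
  induction j using Nat.strong_induction_on with
  | _ j ih =>
    cases j with
    | zero => simp [homog_zero]
    | succ j =>
      rw [homog_succ]
      exact div_nonneg (Finset.sum_nonneg fun i _ => mul_nonneg (hp _) (ih _ (by omega)))
        (by positivity)

lemma homog_mono {p q : ℕ → ℝ} (hp : ∀ i, 0 ≤ p i) (hpq : ∀ i, 1 ≤ i → p i ≤ q i) (j : ℕ) :
    homog p j ≤ homog q j := by
  induction j using Nat.strong_induction_on with
  | _ j ih =>
    cases j with
    | zero => simp [homog_zero]
    | succ j =>
      rw [homog_succ, homog_succ]
      gcongr with i hi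
      · exact homog_nonneg hp _
      · exact (hp (i + 1)).trans (hpq _ (by omega))
      · exact hpq _ (by omega)
      · exact ih _ (by omega)

lemma homog_pos {p : ℕ → ℝ} (hp : ∀ i, 0 ≤ p i) (h1 : 0 < p 1) (j : ℕ) : 0 < homog p j := by
  induction j with
  | zero => simp [homog_zero]
  | succ j ih =>
    rw [homog_succ]
    refine div_pos (Finset.sum_pos' (fun i _ => mul_nonneg (hp _) (homog_nonneg hp _))
      ⟨0, by simp, ?_⟩) (by positivity)
    simpa using mul_pos h1 ih

lemma homog_le_one {p : ℕ → ℝ} (hp : ∀ i, 0 ≤ p i) (h1 : ∀ i, 1 ≤ i → p i ≤ 1) (j : ℕ) :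
    homog p j ≤ 1 := by
  induction j using Nat.strong_induction_on with
  | _ j ih =>
    cases j with
    | zero => simp [homog_zero]
    | succ j =>
      rw [homog_succ, div_le_one (by positivity)]
      calc _ ≤ ∑ i ∈ Finset.range (j + 1), (1 : ℝ) := Finset.sum_le_sum fun i _ =>
            mul_le_one₀ (h1 _ (by omega)) (homog_nonneg hp _) (ih _ (by omega))
        _ = j + 1 := by simp

lemma tendsto_homog {ι : Type*} {l : Filter ι} {p : ι → ℕ → ℝ} {q : ℕ → ℝ}
    (h : ∀ i, 1 ≤ i → Tendsto (fun t => p t i) l (𝓝 (q i))) (j : ℕ) :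
    Tendsto (fun t => homog (p t) j) l (𝓝 (homog q j)) := by
  induction j using Nat.strong_induction_on with
  | _ j ih =>
    cases j with
    | zero => simpa [homog_zero] using tendsto_const_nhds
    | succ j =>
      simp only [homog_succ]
      exact (tendsto_finsetSum _ fun i _ => (h _ (by omega)).mul (ih _ (by omega))).div_const _

/-- The derivative of `homog` at `p` in direction `q`. -/
noncomputable def dhomog (p q : ℕ → ℝ) : ℕ → ℝ
  | 0 => 0
  | j + 1 => (∑ i : Fin (j + 1), (q (i + 1) * homog p (j - i) + p (i + 1) * dhomog p q (j - i)))
      / (j + 1)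

lemma dhomog_zero (p q : ℕ → ℝ) : dhomog p q 0 = 0 := by rw [dhomog]

lemma dhomog_succ (p q : ℕ → ℝ) (j : ℕ) :
    dhomog p q (j + 1) = (∑ i ∈ Finset.range (j + 1),
      (q (i + 1) * homog p (j - i) + p (i + 1) * dhomog p q (j - i))) / (j + 1) := by
  rw [dhomog, Finset.sum_range]

lemma hasDerivAt_homog {p : ℝ → ℕ → ℝ} {q : ℕ → ℝ} {x : ℝ}
    (h : ∀ i, 1 ≤ i → HasDerivAt (fun t => p t i) (q i) x) (j : ℕ) :
    HasDerivAt (fun t => homog (p t) j) (dhomog (p x) q j) x := by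
  induction j using Nat.strong_induction_on with
  | _ j ih =>
    cases j with
    | zero => simpa [homog_zero, dhomog_zero] using hasDerivAt_const x (1 : ℝ)
    | succ j =>
      simp only [homog_succ, dhomog_succ]
      refine HasDerivAt.div_const (HasDerivAt.fun_sum fun i _ => ?_) _
      exact (h _ (by omega)).mul (ih _ (by omega))

lemma dhomog_linear (p q q' e : ℕ → ℝ) (r v : ℝ) (j : ℕ) :
    dhomog p (fun i => q i - r * q' i + v * e i) j
      = dhomog p q j - r * dhomog p q' j + v * dhomog p e j := by
  induction j using Nat.strong_induction_on with
  | _ j ih =>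
    cases j with
    | zero => simp [dhomog_zero]
    | succ j =>
      simp only [dhomog_succ]
      rw [mul_div_assoc', mul_div_assoc', ← sub_div, ← add_div, Finset.mul_sum, Finset.mul_sum,
        ← Finset.sum_sub_distrib, ← Finset.sum_add_distrib]
      congr 1
      refine Finset.sum_congr rfl fun i _ => ?_
      rw [ih _ (by omega)]
      ring

lemma dhomog_nonneg {p q : ℕ → ℝ} (hp : ∀ i, 0 ≤ p i) (hq : ∀ i, 0 ≤ q i) (j : ℕ) :
    0 ≤ dhomog p q j := by
  induction j using Nat.strong_induction_on with
  | _ j ih =>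
    cases j with
    | zero => simp [dhomog_zero]
    | succ j =>
      rw [dhomog_succ]
      exact div_nonneg (Finset.sum_nonneg fun i _ => add_nonneg
        (mul_nonneg (hq _) (homog_nonneg hp _)) (mul_nonneg (hp _) (ih _ (by omega))))
        (by positivity)

lemma kdeg_code (m : Multiset ℕ) : kdeg (code m) = m.card := by rw [kdeg, ch_code]

lemma sum_kdeg_le {α : ℝ} {u w : ℕ → ℝ} (hu : ∀ x, 0 ≤ u x) (hα : 0 ≤ α) {j : ℕ}
    (h : ∀ c, kdeg c = j → w c ≤ α * ((ch c).map u).prod) (N : ℕ) :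
    ∑ c ∈ Finset.range (N + 1) with kdeg c = j, w c
      ≤ α * homog (fun i => ∑ x ∈ Finset.range N, u x ^ i) j := by
  rw [← sum_msets_eq_homog]
  calc _ ≤ ∑ c ∈ Finset.range (N + 1) with kdeg c = j, α * ((ch c).map u).prod :=
        Finset.sum_le_sum fun c hc => h c (Finset.mem_filter.1 hc).2
    _ = α * ∑ m ∈ ((Finset.range (N + 1)).filter (kdeg · = j)).image ch, (m.map u).prod := by
        rw [Finset.sum_image fun a _ b _ hab => ch_injective hab, Finset.mul_sum]
    _ ≤ _ := by
        refine mul_le_mul_of_nonneg_left (Finset.sum_le_sum_of_subset_of_nonneg ?_ ?_) hα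
        · intro m hm
          obtain ⟨c, hc, rfl⟩ := Finset.mem_image.1 hm
          rw [Finset.mem_filter, Finset.mem_range] at hc
          refine mem_msets.2 ⟨hc.2, fun x hx => ?_⟩
          have := lt_of_mem_ch hx
          exact Finset.mem_range.2 (by omega)
        · intro m _ _
          refine Multiset.prod_nonneg fun a ha => ?_
          obtain ⟨x, -, rfl⟩ := Multiset.mem_map.1 ha
          exact hu x

lemma homog_le_sum {α : ℝ} {u w : ℕ → ℝ} {j : ℕ}
    (h : ∀ c, kdeg c = j → α * ((ch c).map u).prod ≤ w c) (s : Finset ℕ) :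
    α * homog (fun i => ∑ x ∈ s, u x ^ i) j ≤ ∑ c ∈ (msets s j).image code, w c := by
  rw [← sum_msets_eq_homog, Finset.sum_image fun a _ b _ hab => code_injective hab, Finset.mul_sum]
  refine Finset.sum_le_sum fun m hm => ?_
  have := h (code m) (by rw [kdeg_code, (mem_msets.1 hm).1])
  rwa [ch_code] at this

open Classical in
lemma good_prod {d : ℕ} {c : ℕ} (hc : kdeg c < d) (v : ℕ → ℝ) :
    (if Good d c then ((ch c).map v).prod else 0)
      = ((ch c).map fun x => if Good d x then v x else 0).prod := by
  split_ifs with h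
  · congr 1
    refine Multiset.map_congr rfl fun x hx => ?_
    rw [if_pos ((good_iff.1 h).2 x hx)]
  · symm
    rw [good_iff] at h
    push Not at h
    obtain ⟨x, hx, hx'⟩ := h hc
    exact Multiset.prod_eq_zero (Multiset.mem_map.2 ⟨x, hx, if_neg hx'⟩)

open Classical in
/-- The Boltzmann weight of a rooted tree with out-degrees less than `d`. -/
noncomputable def wt (d : ℕ) (x : ℝ) (c : ℕ) : ℝ := if Good d c then x ^ size c else 0

lemma wt_nonneg {d : ℕ} {x : ℝ} (hx : 0 ≤ x) (c : ℕ) : 0 ≤ wt d x c := by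
  unfold wt; split_ifs <;> positivity

lemma wt_of_good {d : ℕ} {x : ℝ} {c : ℕ} (h : Good d c) : wt d x c = x ^ size c := if_pos h

lemma wt_eq {d : ℕ} (x : ℝ) {c : ℕ} (hc : kdeg c < d) :
    wt d x c = x * ((ch c).map (wt d x)).prod := by
  have h := good_prod hc (fun y => x ^ size y)
  change _ = ((ch c).map (wt d x)).prod at h
  rw [← h, wt, mul_ite, mul_zero, size_eq, pow_add, pow_one]
  congr 2
  induction ch c using Multiset.induction with
  | empty => simp
  | cons a m ih => simp [pow_add, ih]

lemma wt_eq_zero {d : ℕ} (x : ℝ) {c : ℕ} (hc : ¬ kdeg c < d) : wt d x c = 0 :=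
  if_neg fun h => hc (good_iff.1 h).1

lemma sum_range_eq_sum_kdeg {d : ℕ} {w : ℕ → ℝ} (hw : ∀ c, ¬ kdeg c < d → w c = 0)
    (s : Finset ℕ) :
    ∑ c ∈ s, w c = ∑ j ∈ Finset.range d, ∑ c ∈ s with kdeg c = j, w c := by
  have h : ∑ c ∈ s, w c = ∑ c ∈ s with kdeg c < d, w c := by
    rw [Finset.sum_filter]
    refine Finset.sum_congr rfl fun c _ => ?_
    split_ifs with hc
    · rfl
    · exact hw c hc
  rw [h, ← Finset.sum_fiberwise_of_maps_to (g := kdeg) (t := Finset.range d) (by simp)]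
  refine Finset.sum_congr rfl fun j hj => ?_
  rw [Finset.filter_filter]
  congr 1
  ext c
  simp only [Finset.mem_filter, Finset.mem_range] at hj ⊢
  grind

lemma sum_wt_le_one {d : ℕ} (hd : 0 < d) (N : ℕ) :
    ∑ c ∈ Finset.range N, wt d (1 / d) c ≤ 1 := by
  have hx : (0 : ℝ) ≤ 1 / d := by positivity
  induction N with
  | zero => simp
  | succ N ih =>
    rw [sum_range_eq_sum_kdeg (d := d) fun c hc => wt_eq_zero _ hc]
    have hle : ∀ c, wt d (1 / d) c ≤ 1 := by
      intro c
      unfold wt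
      split_ifs
      · refine pow_le_one₀ hx ?_
        rw [div_le_one (by positivity)]
        exact_mod_cast hd
      · exact zero_le_one
    calc _ ≤ ∑ j ∈ Finset.range d, (1 / d : ℝ) := by
          refine Finset.sum_le_sum fun j hj => ?_
          refine (sum_kdeg_le (α := 1 / d) (u := wt d (1 / d)) (wt_nonneg hx) hx
            (fun c hc => (wt_eq _ (by rw [hc]; exact Finset.mem_range.1 hj)).le) N).trans ?_
          refine mul_le_of_le_one_right hx (homog_le_one
            (fun i => Finset.sum_nonneg fun c _ => pow_nonneg (wt_nonneg hx c) _) ?_ j)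
          intro i hi
          refine le_trans (Finset.sum_le_sum fun c _ => ?_) ih
          exact pow_le_of_le_one (wt_nonneg hx c) (hle c) (by omega)
      _ = 1 := by simp; field_simp

lemma sum_wt_eq {d : ℕ} {x : ℝ} {n : ℕ} {T : Finset ℕ}
    (hT : ∀ c ∈ T, Good d c ∧ size c = n) : ∑ c ∈ T, wt d x c = T.card * x ^ n := by
  rw [Finset.sum_congr rfl fun c hc => by rw [wt_of_good (hT c hc).1, (hT c hc).2],
    Finset.sum_const, nsmul_eq_mul]

lemma card_le_pow {d : ℕ} (hd : 0 < d) {n : ℕ} {T : Finset ℕ}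
    (hT : ∀ c ∈ T, Good d c ∧ size c = n) : (T.card : ℝ) ≤ d ^ n := by
  obtain ⟨N, hN⟩ := T.exists_nat_subset_range
  have h := (Finset.sum_le_sum_of_subset_of_nonneg hN fun c _ _ =>
    wt_nonneg (d := d) (x := 1 / d) (by positivity) c).trans (sum_wt_le_one hd N)
  rw [sum_wt_eq hT, one_div, inv_pow, ← div_eq_mul_inv, div_le_one (by positivity)] at h
  exact h

lemma finite_good (d n : ℕ) : {c | Good d c ∧ size c = n}.Finite := by
  rcases Nat.eq_zero_or_pos d with rfl | hd
  · convert Set.finite_empty (α := ℕ)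
    ext c
    simp only [Set.mem_ofPred_eq, Set.mem_empty_iff_false, iff_false]
    exact fun h => absurd (good_iff.1 h.1).1 (Nat.not_lt_zero _)
  by_contra h
  obtain ⟨T, hT, hc⟩ := Set.Infinite.exists_subset_card_eq h (d ^ n + 1)
  have := card_le_pow hd (T := T) (n := n) fun c hc => hT hc
  rw [hc] at this
  push_cast at this
  linarith

/-- The rooted trees with `n` vertices and out-degrees less than `d`. -/
noncomputable def trees (d n : ℕ) : Finset ℕ := (finite_good d n).toFinset

lemma mem_trees {d n c : ℕ} : c ∈ trees d n ↔ Good d c ∧ size c = n := by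
  simp [trees]

lemma size_code (m : Multiset ℕ) : size (code m) = 1 + (m.map size).sum := by
  rw [size_eq, ch_code]

lemma good_code {d : ℕ} {m : Multiset ℕ} (hm : m.card < d) (h : ∀ x ∈ m, Good d x) :
    Good d (code m) :=
  good_iff.2 ⟨by rwa [kdeg_code], by rwa [ch_code]⟩

lemma card_trees_mul_le {d : ℕ} (hd : 3 ≤ d) (a b : ℕ) :
    (trees d a).card * (trees d b).card ≤ 2 * (trees d (a + b + 1)).card := by
  rw [← Finset.card_product]
  refine (Finset.card_le_mul_card_image (f := fun p : ℕ × ℕ => code {p.1, p.2}) _ 2 ?_).trans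
    (Nat.mul_le_mul_left 2 (Finset.card_le_card ?_))
  · intro c hc
    obtain ⟨⟨u, v⟩, -, rfl⟩ := Finset.mem_image.1 hc
    refine (Finset.card_le_card (t := {(u, v), (v, u)}) ?_).trans Finset.card_le_two
    rintro ⟨u', v'⟩ h
    have h := code_injective (Finset.mem_filter.1 h).2
    simp only [Multiset.insert_eq_cons] at h
    rw [Multiset.cons_eq_cons] at h
    simp only [Finset.mem_insert, Finset.mem_singleton, Prod.mk.injEq]
    rcases h with ⟨rfl, h'⟩ | ⟨-, cs, h1, h2⟩
    · left; exact ⟨rfl, Multiset.singleton_inj.1 h'⟩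
    · right
      have h3 : cs = 0 := by
        have := congrArg Multiset.card h1
        simpa using this
      subst h3
      exact ⟨(Multiset.singleton_inj.1 h2).symm, Multiset.singleton_inj.1 h1⟩
  · intro c hc
    obtain ⟨⟨u, v⟩, h, rfl⟩ := Finset.mem_image.1 hc
    rw [Finset.mem_product, mem_trees, mem_trees] at h
    obtain ⟨⟨h1, h2⟩, h3, h4⟩ := h
    refine mem_trees.2 ⟨good_code (by simp; omega) ?_, ?_⟩
    · simp [h1, h3]
    · simp [size_code] at h2 h4 ⊢
      omega

lemma code_singleton_mem_trees {d : ℕ} (hd : 2 ≤ d) {n c : ℕ} (hc : c ∈ trees d n) :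
    code {c} ∈ trees d (n + 1) := by
  rw [mem_trees] at hc ⊢
  refine ⟨good_code (by simp; omega) (by simp [hc.1]), ?_⟩
  simp [size_code, hc.2]; omega

lemma card_trees_succ_le {d : ℕ} (hd : 2 ≤ d) (n : ℕ) :
    (trees d n).card ≤ (trees d (n + 1)).card :=
  Finset.card_le_card_of_injOn (fun c => code {c})
    (fun _ hc => code_singleton_mem_trees hd hc)
    (fun _ _ _ _ h => Multiset.singleton_inj.1 (code_injective h))

lemma one_vertex_mem_trees {d : ℕ} (hd : 1 ≤ d) : code 0 ∈ trees d 1 :=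
  mem_trees.2 ⟨good_code (by simp; omega) (by simp), by simp [size_code]⟩

lemma card_trees_pos {d : ℕ} (hd : 2 ≤ d) {n : ℕ} (hn : 1 ≤ n) : 1 ≤ (trees d n).card := by
  induction n, hn using Nat.le_induction with
  | base => exact Finset.card_pos.2 ⟨_, one_vertex_mem_trees (by omega)⟩
  | succ n _ ih => exact ih.trans (card_trees_succ_le hd n)

lemma three_le_card_trees_four {d : ℕ} (hd : 3 ≤ d) : 3 ≤ (trees d 4).card := by
  have h1 := one_vertex_mem_trees (d := d) (by omega)
  have h2 := code_singleton_mem_trees (by omega) h1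
  have h3 := code_singleton_mem_trees (by omega) h2
  have h4 := code_singleton_mem_trees (by omega) h3
  have hpair : ∀ {a b x y : ℕ}, x ∈ trees d a → y ∈ trees d b →
      code {x, y} ∈ trees d (a + b + 1) := by
    intro a b x y hx hy
    rw [mem_trees] at hx hy ⊢
    refine ⟨good_code (by simp; omega) (by simp [hx.1, hy.1]), ?_⟩
    simp [size_code, hx.2, hy.2]; omega
  have h5 := code_singleton_mem_trees (by omega) (hpair h1 h1)
  have h6 := hpair h1 h2
  rw [show 3 = ({code {code {code {code 0}}}, code {code {code 0, code 0}},
    code {code 0, code {code 0}}} : Finset ℕ).card from ?_]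
  · refine Finset.card_le_card fun c hc => ?_
    simp only [Finset.mem_insert, Finset.mem_singleton] at hc
    rcases hc with rfl | rfl | rfl
    · exact h4
    · exact h5
    · exact h6
  · symm
    have hk : ∀ {m m' : Multiset ℕ}, m.card ≠ m'.card → code m ≠ code m' :=
      fun h h' => h (by rw [code_injective h'])
    refine Finset.card_eq_three.2 ⟨_, _, _, ?_, ?_, ?_, rfl⟩
    · intro h
      have := Multiset.singleton_inj.1 (code_injective h)
      exact hk (by simp) this
    · exact hk (by simp)
    · exact hk (by simp)

/-- Half the number of rooted trees with one vertex less, normalized for small `n`. -/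
noncomputable def halfCount (d : ℕ) : ℕ → ℝ
  | 0 => 1
  | 1 => 1 / 2
  | n + 2 => (trees d (n + 1)).card / 2

lemma halfCount_pos {d : ℕ} (hd : 3 ≤ d) (n : ℕ) : 0 < halfCount d n := by
  match n with
  | 0 => simp [halfCount]
  | 1 => simp [halfCount]
  | n + 2 =>
    have := card_trees_pos (d := d) (by omega) (n := n + 1) (by omega)
    simp only [halfCount]
    have : (1 : ℝ) ≤ (trees d (n + 1)).card := by exact_mod_cast this
    positivity

lemma halfCount_succ {d : ℕ} (hd : 3 ≤ d) (n : ℕ) :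
    halfCount d 1 * halfCount d n ≤ halfCount d (1 + n) := by
  match n with
  | 0 => simp [halfCount]
  | 1 =>
    have := card_trees_pos (d := d) (by omega) (n := 1) (by omega)
    have : (1 : ℝ) ≤ (trees d 1).card := by exact_mod_cast this
    simp only [halfCount]
    linarith
  | n + 2 =>
    have := card_trees_succ_le (d := d) (by omega) (n + 1)
    have : ((trees d (n + 1)).card : ℝ) ≤ (trees d (n + 2)).card := by exact_mod_cast this
    rw [show 1 + (n + 2) = (n + 1) + 2 by ring]
    simp only [halfCount]
    have h0 : (0 : ℝ) ≤ (trees d (n + 1)).card := by positivity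
    linarith

lemma halfCount_mul_le {d : ℕ} (hd : 3 ≤ d) (m n : ℕ) :
    halfCount d m * halfCount d n ≤ halfCount d (m + n) := by
  match m, n with
  | 0, n => simp [halfCount]
  | 1, n => exact halfCount_succ hd n
  | m + 2, 0 => simp [halfCount]
  | m + 2, 1 => rw [mul_comm, add_comm (m + 2)]; exact halfCount_succ hd _
  | m + 2, n + 2 =>
    have := card_trees_mul_le hd (m + 1) (n + 1)
    have : ((trees d (m + 1)).card * (trees d (n + 1)).card : ℝ)
      ≤ 2 * (trees d (m + 1 + (n + 1) + 1)).card := by exact_mod_cast this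
    rw [show m + 2 + (n + 2) = (m + 1 + (n + 1)) + 2 by ring]
    simp only [halfCount]
    linarith

lemma halfCount_le {d : ℕ} (hd : 3 ≤ d) (n : ℕ) : halfCount d n ≤ d ^ n := by
  have h1 : (1 : ℝ) ≤ d := by exact_mod_cast (by omega : 1 ≤ d)
  match n with
  | 0 => simp [halfCount]
  | 1 => simp only [halfCount]; linarith
  | n + 2 =>
    have := card_le_pow (d := d) (by omega) (n := n + 1) (T := trees d (n + 1))
      fun c hc => mem_trees.1 hc
    simp only [halfCount]
    have h2 : (d : ℝ) ^ (n + 1) ≤ d ^ (n + 2) := pow_le_pow_right₀ h1 (by omega)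
    have h3 : (0 : ℝ) ≤ d ^ (n + 1) := by positivity
    linarith

/-- Exponential growth of the number of rooted trees, at the rate `ρ⁻¹`. -/
lemma exists_radius {d : ℕ} (hd : 3 ≤ d) : ∃ ρ : ℝ, 0 < ρ ∧ ρ < 1 ∧
    (∀ n, 1 ≤ n → (trees d n).card * ρ ^ n ≤ 2 / ρ) ∧
    ∀ η : ℝ, 0 < η → ∀ᶠ n : ℕ in atTop, Real.exp (-(η * n)) ≤ (trees d n).card * ρ ^ n := by
  have hsub : Subadditive fun n => -Real.log (halfCount d n) := by
    intro m n
    have := Real.log_le_log (mul_pos (halfCount_pos hd m) (halfCount_pos hd n))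
      (halfCount_mul_le hd m n)
    rw [Real.log_mul (halfCount_pos hd m).ne' (halfCount_pos hd n).ne'] at this
    linarith
  have hbdd : BddBelow (Set.range fun n : ℕ => -Real.log (halfCount d n) / n) := by
    refine ⟨-Real.log d, ?_⟩
    rintro _ ⟨n, rfl⟩
    have hlogd : 0 ≤ Real.log d := Real.log_natCast_nonneg d
    rcases Nat.eq_zero_or_pos n with rfl | hn
    · simpa using hlogd
    · have hn' : (0 : ℝ) < n := by exact_mod_cast hn
      have := Real.log_le_log (halfCount_pos hd n) (halfCount_le hd n)
      rw [Real.log_pow] at this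
      change _ ≤ -Real.log (halfCount d n) / n
      rw [le_div_iff₀ hn']
      linarith
  set L := hsub.lim with hL
  have hle : ∀ n, 1 ≤ n → halfCount d n ≤ Real.exp (-(L * n)) := by
    intro n hn
    have hn' : (0 : ℝ) < n := by exact_mod_cast hn
    have := hsub.lim_le_div hbdd (n := n) (by omega)
    rw [← hL, le_div_iff₀ hn'] at this
    rw [← Real.log_le_iff_le_exp (halfCount_pos hd n)]
    linarith
  have hpow : ∀ n : ℕ, Real.exp L ^ n = Real.exp (L * n) := fun n => by
    rw [mul_comm, Real.exp_nat_mul]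
  have hcard : ∀ n, 1 ≤ n → ((trees d n).card : ℝ) = 2 * halfCount d (n + 1) := by
    intro n hn
    obtain ⟨k, rfl⟩ := Nat.exists_eq_add_of_le' hn
    simp only [halfCount]; ring
  refine ⟨Real.exp L, Real.exp_pos L, ?_, ?_, ?_⟩
  · rw [Real.exp_lt_one_iff]
    have h5 := hle 5 (by omega)
    have h4 : (3 : ℝ) ≤ (trees d 4).card := by exact_mod_cast three_le_card_trees_four hd
    rw [show halfCount d 5 = (trees d 4).card / 2 from rfl] at h5
    by_contra hneg
    have : Real.exp (-(L * (5 : ℕ))) ≤ 1 := Real.exp_le_one_iff.2 (by push_cast; linarith)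
    have := h5.trans this
    linarith
  · intro n hn
    rw [hcard n hn, hpow]
    have h := hle (n + 1) (by omega)
    calc 2 * halfCount d (n + 1) * Real.exp (L * n)
        ≤ 2 * Real.exp (-(L * (n + 1 : ℕ))) * Real.exp (L * n) := by gcongr
      _ = 2 / Real.exp L := by
          rw [div_eq_mul_inv, ← Real.exp_neg, mul_assoc, ← Real.exp_add]
          push_cast; ring_nf
  · intro η hη
    have ht := (hsub.tendsto_lim hbdd).comp (tendsto_add_atTop_nat 1)
    have h1 := (tendsto_order.1 ht).2 (L + η / 2) (by rw [← hL]; linarith)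
    have h2 : ∀ᶠ n : ℕ in atTop, L + η / 2 ≤ η / 2 * n :=
      (tendsto_natCast_atTop_atTop.const_mul_atTop (half_pos hη)).eventually_ge_atTop _
    filter_upwards [h1, h2, eventually_ge_atTop 1] with n h1 h2 hn
    rw [hcard n hn, hpow]
    have hn' : (0 : ℝ) < (n + 1 : ℕ) := by positivity
    simp only [Function.comp_apply] at h1
    rw [div_lt_iff₀ hn'] at h1
    have h3 : Real.exp (-((L + η / 2) * (n + 1 : ℕ))) ≤ halfCount d (n + 1) := by
      rw [← Real.le_log_iff_exp_le (halfCount_pos hd _)]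
      linarith
    calc Real.exp (-(η * n)) ≤ Real.exp (-((L + η / 2) * (n + 1 : ℕ))) * Real.exp (L * n) := by
          rw [← Real.exp_add]
          apply Real.exp_le_exp.2
          push_cast
          nlinarith
      _ ≤ halfCount d (n + 1) * Real.exp (L * n) := by gcongr
      _ ≤ 2 * halfCount d (n + 1) * Real.exp (L * n) := by
          have := halfCount_pos hd (n + 1)
          have := Real.exp_pos (L * n)
          nlinarith [mul_pos ‹0 < halfCount d (n+1)› this]

lemma sum_wt_le_geometric {d : ℕ} {ρ : ℝ} (hρ : 0 < ρ)
    (hcard : ∀ n, 1 ≤ n → (trees d n).card * ρ ^ n ≤ 2 / ρ) {x : ℝ} (hx0 : 0 ≤ x) (hx : x < ρ)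
    (s : Finset ℕ) : ∑ c ∈ s, wt d x c ≤ 2 / ρ * ∑' n, (x / ρ) ^ n := by
  have hr0 : 0 ≤ x / ρ := by positivity
  have hsum : Summable fun n : ℕ => (x / ρ) ^ n :=
    summable_geometric_of_lt_one hr0 ((div_lt_one hρ).2 hx)
  rw [← Finset.sum_fiberwise_of_maps_to (g := size) (t := s.image size)
    (fun c hc => Finset.mem_image_of_mem _ hc)]
  calc _ ≤ ∑ n ∈ s.image size, 2 / ρ * (x / ρ) ^ n := by
        refine Finset.sum_le_sum fun n hn => ?_
        obtain ⟨c₀, -, rfl⟩ := Finset.mem_image.1 hn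
        calc ∑ c ∈ s with size c = size c₀, wt d x c
            ≤ ∑ c ∈ trees d (size c₀), wt d x c := by
              classical
              rw [← Finset.sum_filter_of_ne (p := Good d)]
              · refine Finset.sum_le_sum_of_subset_of_nonneg ?_ fun c _ _ => wt_nonneg hx0 c
                intro c hc
                simp only [Finset.mem_filter] at hc
                exact mem_trees.2 ⟨hc.2, hc.1.2⟩
              · intro c _ h
                by_contra hg
                exact h (if_neg hg)
          _ = (trees d (size c₀)).card * x ^ size c₀ := sum_wt_eq fun c hc => mem_trees.1 hc
          _ = (trees d (size c₀)).card * ρ ^ size c₀ * (x / ρ) ^ size c₀ := by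
              rw [div_pow]; field_simp
          _ ≤ _ := by gcongr; exact hcard _ (size_pos _)
    _ ≤ _ := by
        rw [← Finset.mul_sum]
        gcongr
        exact hsum.sum_le_tsum _ fun n _ => by positivity

lemma sum_wt_le_of_lt {d : ℕ} (hd : 3 ≤ d) {x : ℝ} (hx0 : 0 < x) {B : ℝ}
    (hB : ∀ s : Finset ℕ, ∑ c ∈ s, wt d x c ≤ B) (s : Finset ℕ) :
    ∑ c ∈ s, wt d x c ≤ 2 / x := by
  have hsum : Summable (wt d x) := summable_of_sum_le (wt_nonneg hx0.le) hB
  have h2 : ∀ s : Finset ℕ, x * (∑ c ∈ s, wt d x c) ^ 2 / 2 ≤ ∑' c, wt d x c := by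
    intro s
    have h := homog_le_sum (α := x) (u := wt d x) (w := wt d x) (j := 2)
      (fun c hc => (wt_eq x (by omega)).ge) s
    refine le_trans ?_ (h.trans (hsum.sum_le_tsum _ fun c _ => wt_nonneg hx0.le c))
    have h3 : 0 ≤ ∑ c ∈ s, wt d x c ^ 2 := Finset.sum_nonneg fun c _ => sq_nonneg _
    simp only [homog_succ, Finset.sum_range_succ, Finset.sum_range_zero]
    norm_num [homog_zero]
    rw [mul_div_assoc]
    gcongr
    nlinarith
  have hlim := le_of_tendsto (((hsum.hasSum.pow 2).const_mul x).div_const 2)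
    (Eventually.of_forall h2)
  have hY0 : 0 ≤ ∑' c, wt d x c := tsum_nonneg (wt_nonneg hx0.le)
  refine (hsum.sum_le_tsum s fun c _ => wt_nonneg hx0.le c).trans ?_
  rw [le_div_iff₀ hx0]
  rcases hY0.eq_or_lt with h | h
  · rw [← h]; norm_num
  · by_contra hlt
    push Not at hlt
    nlinarith [mul_lt_mul_of_pos_left hlt h]

lemma summable_wt {d : ℕ} (hd : 3 ≤ d) {ρ : ℝ} (hρ : 0 < ρ)
    (hcard : ∀ n, 1 ≤ n → (trees d n).card * ρ ^ n ≤ 2 / ρ) : Summable (wt d ρ) := by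
  refine summable_of_sum_le (c := 2 / ρ) (wt_nonneg hρ.le) fun s => ?_
  have hcont : Continuous fun x => ∑ c ∈ s, wt d x c := by
    refine continuous_finsetSum _ fun c _ => ?_
    unfold wt
    split_ifs <;> fun_prop
  have h1 : Tendsto (fun x => ∑ c ∈ s, wt d x c) (𝓝[<] ρ) (𝓝 (∑ c ∈ s, wt d ρ c)) :=
    hcont.continuousAt.tendsto.mono_left nhdsWithin_le_nhds
  have h2 : Tendsto (fun x => 2 / x) (𝓝[<] ρ) (𝓝 (2 / ρ)) :=
    (tendsto_const_nhds.div tendsto_id hρ.ne').mono_left nhdsWithin_le_nhds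
  refine le_of_tendsto_of_tendsto h1 h2 ?_
  filter_upwards [self_mem_nhdsWithin, mem_nhdsWithin_of_mem_nhds (lt_mem_nhds hρ)] with x hx hx0
  exact sum_wt_le_of_lt hd hx0 (sum_wt_le_geometric hρ hcard (le_of_lt hx0) hx) s

lemma hasDerivAt_tsum_exp {q g : ℕ → ℝ} (hq : ∀ c, 0 ≤ q c) {δ : ℝ} (hδ : 0 < δ)
    (hs : Summable fun c => q c * Real.exp (δ * |g c|)) :
    (Summable fun c => q c * g c) ∧
      HasDerivAt (fun θ => ∑' c, q c * Real.exp (θ * g c)) (∑' c, q c * g c) 0 := by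
  have hu : Summable fun c => 2 / δ * (q c * Real.exp (δ * |g c|)) := hs.mul_left _
  have hb : ∀ c, ∀ y ∈ Metric.ball (0 : ℝ) (δ / 2),
      ‖q c * (Real.exp (y * g c) * g c)‖ ≤ 2 / δ * (q c * Real.exp (δ * |g c|)) := by
    intro c y hy
    rw [Metric.mem_ball, dist_zero_right, Real.norm_eq_abs] at hy
    rw [norm_mul, norm_mul, Real.norm_of_nonneg (hq c), Real.norm_of_nonneg (Real.exp_pos _).le,
      Real.norm_eq_abs]
    have h1 : Real.exp (y * g c) ≤ Real.exp (δ / 2 * |g c|) := by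
      apply Real.exp_le_exp.2
      calc y * g c ≤ |y * g c| := le_abs_self _
        _ = |y| * |g c| := abs_mul _ _
        _ ≤ _ := by gcongr
    have h2 : |g c| ≤ 2 / δ * Real.exp (δ / 2 * |g c|) := by
      have := Real.add_one_le_exp (δ / 2 * |g c|)
      rw [div_mul_eq_mul_div, le_div_iff₀ hδ]
      nlinarith
    calc q c * (Real.exp (y * g c) * |g c|)
        ≤ q c * (Real.exp (δ / 2 * |g c|) * (2 / δ * Real.exp (δ / 2 * |g c|))) := by
          gcongr
          exact hq c
      _ = 2 / δ * (q c * (Real.exp (δ / 2 * |g c|) * Real.exp (δ / 2 * |g c|))) := by ring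
      _ = _ := by rw [← Real.exp_add]; ring_nf
  have h0 : (0 : ℝ) ∈ Metric.ball (0 : ℝ) (δ / 2) := Metric.mem_ball_self (half_pos hδ)
  constructor
  · refine Summable.of_norm_bounded hu fun c => ?_
    simpa using hb c 0 h0
  · have hq0 : Summable fun c => q c * Real.exp (0 * g c) := by
      refine Summable.of_nonneg_of_le (fun c => mul_nonneg (hq c) (Real.exp_pos _).le)
        (fun c => ?_) hs
      exact mul_le_mul_of_nonneg_left (Real.exp_le_exp.2 (by rw [zero_mul]; positivity)) (hq c)
    have := hasDerivAt_tsum_of_isPreconnected hu Metric.isOpen_ball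
      (convex_ball (0 : ℝ) (δ / 2)).isPreconnected
      (g := fun c θ => q c * Real.exp (θ * g c))
      (g' := fun c θ => q c * (Real.exp (θ * g c) * g c))
      (fun c y _ => (((hasDerivAt_id y).mul_const (g c)).exp.const_mul (q c)).congr_deriv
        (by simp)) hb h0 hq0 h0
    simpa using this

lemma summable_wt_pow_exp {d : ℕ} {ρ : ℝ} (hρ : 0 < ρ) (hs : Summable (wt d ρ))
    {g : ℕ → ℝ} {L δ : ℝ} (hg : ∀ c, Good d c → |g c| ≤ L * size c)
    (hδ : 0 ≤ δ) (hδL : ρ * Real.exp (2 * δ * L) ≤ 1) {k : ℕ} (hk : 2 ≤ k) :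
    Summable fun c => wt d ρ c ^ k * Real.exp (δ * |k * g c|) := by
  refine Summable.of_nonneg_of_le
    (fun c => mul_nonneg (pow_nonneg (wt_nonneg hρ.le c) _) (Real.exp_pos _).le) (fun c => ?_) hs
  by_cases hc : Good d c
  · have hB : wt d ρ c * Real.exp (2 * (δ * |g c|)) ≤ 1 := by
      rw [wt_of_good hc]
      calc ρ ^ size c * Real.exp (2 * (δ * |g c|))
          ≤ ρ ^ size c * Real.exp (size c * (2 * δ * L)) := by
            refine mul_le_mul_of_nonneg_left (Real.exp_le_exp.2 ?_) (by positivity)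
            have := mul_le_mul_of_nonneg_left (hg c hc) hδ
            linarith
        _ = (ρ * Real.exp (2 * δ * L)) ^ size c := by rw [Real.exp_nat_mul, mul_pow]
        _ ≤ 1 := pow_le_one₀ (by positivity) hδL
    have hq := wt_nonneg (d := d) hρ.le c
    have hE : 1 ≤ Real.exp (δ * |g c|) := Real.one_le_exp (by positivity)
    have hE2 : Real.exp (2 * (δ * |g c|)) = Real.exp (δ * |g c|) ^ 2 := by
      rw [← Real.exp_nat_mul]; norm_num
    rw [hE2] at hB
    have hle : wt d ρ c * Real.exp (δ * |g c|) ≤ 1 := by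
      refine le_trans ?_ hB
      gcongr
      nlinarith
    calc wt d ρ c ^ k * Real.exp (δ * |k * g c|)
        = (wt d ρ c * Real.exp (δ * |g c|)) ^ k := by
          rw [mul_pow, ← Real.exp_nat_mul, abs_mul, Nat.abs_cast]; ring_nf
      _ ≤ (wt d ρ c * Real.exp (δ * |g c|)) ^ 2 :=
          pow_le_pow_of_le_one (by positivity) hle hk
      _ = wt d ρ c * (wt d ρ c * Real.exp (δ * |g c|) ^ 2) := by ring
      _ ≤ wt d ρ c * 1 := by gcongr
      _ = wt d ρ c := mul_one _
  · have : wt d ρ c = 0 := if_neg hc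
    rw [this, zero_pow (by omega), zero_mul]

/-- The sum of `f (out-degree of the child) (out-degree of the parent)` over the edges of a
rooted tree. -/
noncomputable def edgeSum (f : ℕ → ℕ → ℝ) : ℕ → ℝ :=
  fold fun c => ((ch c).map fun x => f (kdeg x) (kdeg c)).sum

lemma edgeSum_eq (f : ℕ → ℕ → ℝ) (c : ℕ) :
    edgeSum f c = ((ch c).map fun x => edgeSum f x + f (kdeg x) (kdeg c)).sum := by
  rw [Multiset.sum_map_add, add_comm]
  exact fold_eq _ c

lemma abs_edgeSum_le {d : ℕ} {f : ℕ → ℕ → ℝ} {M : ℝ} (hM : ∀ i < d, ∀ j < d, |f i j| ≤ M)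
    {c : ℕ} (hc : Good d c) : |edgeSum f c| ≤ M * (size c - 1) := by
  induction hc with
  | mk c h1 h2 ih =>
    rw [edgeSum_eq, size_eq]
    have : ∀ m : Multiset ℕ, (∀ x ∈ m, x ∈ ch c) →
        |(m.map fun x => edgeSum f x + f (kdeg x) (kdeg c)).sum|
          ≤ M * (((m.map size).sum : ℕ) : ℝ) := by
      intro m hm
      induction m using Multiset.induction with
      | empty => simp
      | cons a m ihm =>
        simp only [Multiset.map_cons, Multiset.sum_cons, Nat.cast_add]
        have h3 := ihm fun x hx => hm x (Multiset.mem_cons_of_mem hx)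
        have h4 := ih a (hm a (Multiset.mem_cons_self a m))
        have h5 := hM (kdeg a) (good_iff.1 (h2 a (hm a (Multiset.mem_cons_self a m)))).1 _ h1
        have h6 := abs_add_le (edgeSum f a + f (kdeg a) (kdeg c))
          (m.map fun x => edgeSum f x + f (kdeg x) (kdeg c)).sum
        have h7 := abs_add_le (edgeSum f a) (f (kdeg a) (kdeg c))
        linarith
    refine (this (ch c) fun x hx => hx).trans (le_of_eq ?_)
    push_cast
    ring

/-- The weights `wt d ρ` tilted by the deviation of `edgeSum f` from `r * size`, with an extra
exponential damping in the size. -/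
noncomputable def tilt (d : ℕ) (ρ : ℝ) (f : ℕ → ℕ → ℝ) (r η θ : ℝ) (c : ℕ) : ℝ :=
  wt d ρ c * Real.exp (θ * (edgeSum f c - r * size c) - η * |θ| * size c)

lemma tilt_nonneg {d : ℕ} {ρ : ℝ} (hρ : 0 ≤ ρ) (f : ℕ → ℕ → ℝ) (r η θ : ℝ) (c : ℕ) :
    0 ≤ tilt d ρ f r η θ c := mul_nonneg (wt_nonneg hρ c) (Real.exp_pos _).le

lemma tilt_eq {d : ℕ} (ρ : ℝ) (f : ℕ → ℕ → ℝ) (r η θ : ℝ) {c : ℕ} (hc : kdeg c < d) :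
    tilt d ρ f r η θ c = ρ * Real.exp (-(r * θ) - η * |θ|) *
      ((ch c).map fun x => tilt d ρ f r η θ x * Real.exp (θ * f (kdeg x) (kdeg c))).prod := by
  rw [tilt, wt_eq ρ hc, edgeSum_eq, size_eq]
  have : ∀ m : Multiset ℕ, (m.map (wt d ρ)).prod * Real.exp (θ *
      ((m.map fun x => edgeSum f x + f (kdeg x) (kdeg c)).sum - r * ((m.map size).sum : ℕ))
        - η * |θ| * ((m.map size).sum : ℕ))
      = (m.map fun x => tilt d ρ f r η θ x * Real.exp (θ * f (kdeg x) (kdeg c))).prod := by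
    intro m
    induction m using Multiset.induction with
    | empty => simp
    | cons a m ih =>
      simp only [Multiset.map_cons, Multiset.prod_cons, Multiset.sum_cons]
      rw [← ih, tilt, mul_assoc (wt d ρ a) (Real.exp _), ← Real.exp_add, mul_mul_mul_comm,
        ← Real.exp_add]
      congr 2
      push_cast
      ring
  rw [← this, mul_mul_mul_comm, ← Real.exp_add]
  congr 2
  push_cast
  ring

lemma sum_tilt_le {d : ℕ} {ρ : ℝ} (hρ : 0 ≤ ρ) {f : ℕ → ℕ → ℝ} {r η θ : ℝ} {A : ℕ → ℝ}
    {P : ℕ → ℕ → ℝ} (hA : ∀ j < d, 0 ≤ A j)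
    (hP1 : ∀ j < d, ∑ i ∈ Finset.range d, Real.exp (θ * f i j) * A i ≤ P j 1)
    (hP2 : ∀ j < d, ∀ k, 2 ≤ k → ∀ s : Finset ℕ,
      ∑ x ∈ s, (tilt d ρ f r η θ x * Real.exp (θ * f (kdeg x) j)) ^ k ≤ P j k)
    (hstep : ∀ j < d, ρ * Real.exp (-(r * θ) - η * |θ|) * homog (P j) j ≤ A j) (N : ℕ) :
    ∑ c ∈ Finset.range N, tilt d ρ f r η θ c ≤ ∑ j ∈ Finset.range d, A j := by
  have hzero : ∀ c, ¬ kdeg c < d → tilt d ρ f r η θ c = 0 := fun c hc => by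
    rw [tilt, wt_eq_zero ρ hc, zero_mul]
  have key : ∀ N, ∀ j < d, ∑ c ∈ Finset.range N with kdeg c = j, tilt d ρ f r η θ c ≤ A j := by
    intro N
    induction N with
    | zero => intro j hj; simpa using hA j hj
    | succ N ih =>
      intro j hj
      have hu : ∀ x, 0 ≤ tilt d ρ f r η θ x * Real.exp (θ * f (kdeg x) j) := fun x =>
        mul_nonneg (tilt_nonneg hρ f r η θ x) (Real.exp_pos _).le
      refine (sum_kdeg_le hu (α := ρ * Real.exp (-(r * θ) - η * |θ|)) (by positivity)
        (fun c hc => ?_) N).trans (le_trans ?_ (hstep j hj))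
      · subst hc
        exact (tilt_eq ρ f r η θ hj).le
      · refine mul_le_mul_of_nonneg_left (homog_mono
          (fun i => Finset.sum_nonneg fun x _ => pow_nonneg (hu x) i) (fun i hi => ?_) j)
          (by positivity)
        rcases hi.eq_or_lt with rfl | hi
        · refine le_trans ?_ (hP1 j hj)
          simp only [pow_one]
          rw [sum_range_eq_sum_kdeg (d := d) (fun c hc => by rw [hzero c hc, zero_mul])]
          refine Finset.sum_le_sum fun i hi => ?_
          rw [Finset.sum_congr rfl fun c hc => by rw [(Finset.mem_filter.1 hc).2],
            ← Finset.sum_mul, mul_comm]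
          exact mul_le_mul_of_nonneg_left (ih i (Finset.mem_range.1 hi)) (Real.exp_pos _).le
        · exact hP2 j hj i hi _
  rw [sum_range_eq_sum_kdeg hzero]
  exact Finset.sum_le_sum fun j hj => key N j (Finset.mem_range.1 hj)

lemma eventually_exp_mul_le {ψ : ℝ → ℝ} {a b η : ℝ} (hψ : HasDerivAt ψ b 0) (h0 : ψ 0 ≤ a)
    (ha : 0 < a) (hη : 0 < η) :
    ∀ᶠ θ in 𝓝 (0 : ℝ), 0 ≤ a + θ * b ∧ Real.exp (-(η * |θ|)) * ψ θ ≤ a + θ * b := by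
  have h1 := (hasDerivAt_iff_isLittleO.1 hψ).def (c := η * a / 2) (by positivity)
  have h2 : ∀ᶠ θ in 𝓝 (0 : ℝ), a / 2 < a + θ * b := by
    have : ContinuousAt (fun θ : ℝ => a + θ * b) 0 := by fun_prop
    exact this.eventually (lt_mem_nhds (by simpa using half_lt_self ha))
  filter_upwards [h1, h2] with θ h1 h2
  simp only [sub_zero, smul_eq_mul, Real.norm_eq_abs] at h1
  have h3 := (abs_le.1 h1).2
  refine ⟨by linarith, ?_⟩
  rw [Real.exp_neg, inv_mul_le_iff₀ (Real.exp_pos _)]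
  have h4 := Real.add_one_le_exp (η * |θ|)
  have h5 : (η * |θ| + 1) * (a + θ * b) ≤ Real.exp (η * |θ|) * (a + θ * b) :=
    mul_le_mul_of_nonneg_right h4 (by linarith)
  have h6 : η * |θ| * (a / 2) ≤ η * |θ| * (a + θ * b) :=
    mul_le_mul_of_nonneg_left h2.le (by positivity)
  linarith

lemma exists_slope {d : ℕ} (hd : 0 < d) {ρ : ℝ} (hρ : 0 < ρ) {p q' e : ℕ → ℝ} (q : ℕ → ℕ → ℝ)
    (hp : ∀ i, 0 ≤ p i) (hq' : ∀ i, 0 ≤ q' i) :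
    ∃ (r : ℝ) (b : ℕ → ℝ), ∀ j, b j = ρ * (-r * homog p j +
      dhomog p (fun i => q j i - r * q' i + (∑ j ∈ Finset.range d, b j) * e i) j) := by
  set K := ρ * ∑ j ∈ Finset.range d, dhomog p e j with hK
  set D := ρ * ∑ j ∈ Finset.range d, dhomog p (q j) j with hD
  set E := ρ * ∑ j ∈ Finset.range d, (homog p j + dhomog p q' j) with hE
  have hEpos : 0 < E := by
    refine mul_pos hρ (Finset.sum_pos' (fun j _ => add_nonneg (homog_nonneg hp j)
      (dhomog_nonneg hp hq' j)) ⟨0, Finset.mem_range.2 hd, ?_⟩)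
    have := dhomog_nonneg hp hq' 0
    rw [homog_zero]
    linarith
  obtain ⟨r, V, h⟩ : ∃ r V, V = D - r * E + V * K := by
    by_cases h : K = 1
    · exact ⟨D / E, 0, by field_simp; ring⟩
    · have : 1 - K ≠ 0 := sub_ne_zero.2 (Ne.symm h)
      exact ⟨0, D / (1 - K), by field_simp; ring⟩
  have hsum : ∑ j ∈ Finset.range d, ρ * (-r * homog p j +
      dhomog p (fun i => q j i - r * q' i + V * e i) j) = V := by
    simp only [dhomog_linear]
    rw [← Finset.mul_sum]
    conv_rhs => rw [h, hD, hE, hK]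
    simp only [Finset.sum_add_distrib, Finset.sum_sub_distrib, ← Finset.mul_sum]
    ring
  exact ⟨r, _, fun j => by rw [hsum]⟩

lemma exists_pos_mul_exp_le_one {ρ : ℝ} (hρ : ρ < 1) (L : ℝ) :
    ∃ δ : ℝ, 0 < δ ∧ ρ * Real.exp (2 * δ * L) ≤ 1 := by
  have h : Tendsto (fun δ : ℝ => ρ * Real.exp (2 * δ * L)) (𝓝[>] 0) (𝓝 ρ) := by
    have : ContinuousAt (fun δ : ℝ => ρ * Real.exp (2 * δ * L)) 0 := by fun_prop
    have := this.tendsto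
    simp only [mul_zero, zero_mul, Real.exp_zero, mul_one] at this
    exact this.mono_left nhdsWithin_le_nhds
  obtain ⟨δ, h1, h2⟩ := ((h.eventually (ge_mem_nhds hρ)).and self_mem_nhdsWithin).exists
  exact ⟨δ, h2, h1⟩

lemma exists_summable_wt_pow {d : ℕ} {ρ : ℝ} (hρ : 0 < ρ) (hρ1 : ρ < 1) (hs : Summable (wt d ρ))
    {g : ℕ → ℝ} {L : ℝ} (hg : ∀ c, Good d c → |g c| ≤ L * size c) :
    ∃ δ : ℝ, 0 < δ ∧ ∀ k : ℕ, 2 ≤ k →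
      Summable fun c => wt d ρ c ^ k * Real.exp (δ * |k * g c|) := by
  obtain ⟨δ, h0, h1⟩ := exists_pos_mul_exp_le_one hρ1 L
  exact ⟨δ, h0, fun k hk => summable_wt_pow_exp hρ hs hg h0.le h1 hk⟩

/-- The total weight of the trees whose root has out-degree `j`. -/
noncomputable def rootWt (d : ℕ) (ρ : ℝ) (j : ℕ) : ℝ :=
  ∑' c, if kdeg c = j then wt d ρ c else 0

lemma summable_rootWt {d : ℕ} {ρ : ℝ} (hρ : 0 < ρ) (hs : Summable (wt d ρ)) (j : ℕ) :
    Summable fun c => if kdeg c = j then wt d ρ c else 0 := by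
  refine Summable.of_nonneg_of_le (fun c => ?_) (fun c => ?_) hs
  · split_ifs
    exacts [wt_nonneg hρ.le c, le_rfl]
  · split_ifs
    exacts [le_rfl, wt_nonneg hρ.le c]

lemma sum_rootWt {d : ℕ} {ρ : ℝ} (hρ : 0 < ρ) (hs : Summable (wt d ρ)) :
    ∑ j ∈ Finset.range d, rootWt d ρ j = ∑' c, wt d ρ c := by
  simp only [rootWt]
  rw [← Summable.tsum_finsetSum fun j _ => summable_rootWt hρ hs j]
  refine tsum_congr fun c => ?_
  rw [Finset.sum_ite_eq]
  split_ifs with h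
  · rfl
  · exact (wt_eq_zero ρ (by simpa using h)).symm

lemma summable_wt_pow {d : ℕ} {ρ : ℝ} (hρ : 0 < ρ) (hρ1 : ρ < 1) (hs : Summable (wt d ρ))
    {k : ℕ} (hk : 1 ≤ k) : Summable fun c => wt d ρ c ^ k := by
  rcases hk.eq_or_lt with rfl | hk
  · simpa using hs
  · simpa using summable_wt_pow_exp hρ hs (g := fun _ => 0) (L := 0) (δ := 0) (by simp) le_rfl
      (by simpa using hρ1.le) hk

lemma homog_le_rootWt {d : ℕ} {ρ : ℝ} (hρ : 0 < ρ) (hρ1 : ρ < 1) (hs : Summable (wt d ρ))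
    {j : ℕ} (hj : j < d) : ρ * homog (fun k => ∑' c, wt d ρ c ^ k) j ≤ rootWt d ρ j := by
  refine le_of_tendsto ((tendsto_homog (l := atTop)
    (p := fun (s : Finset ℕ) k => ∑ c ∈ s, wt d ρ c ^ k)
    (fun k hk => (summable_wt_pow hρ hρ1 hs hk).hasSum) j).const_mul ρ)
    (Eventually.of_forall fun s => ?_)
  refine (homog_le_sum (w := fun c => if kdeg c = j then wt d ρ c else 0) (fun c hc => ?_)
    s).trans ((summable_rootWt hρ hs j).sum_le_tsum _ fun c _ => ?_)
  · rw [if_pos hc]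
    exact (wt_eq ρ (by omega)).ge
  · split_ifs
    exacts [wt_nonneg hρ.le c, le_rfl]

lemma tsum_wt_pos {d : ℕ} (hd : 0 < d) {ρ : ℝ} (hρ : 0 < ρ) (hs : Summable (wt d ρ)) :
    0 < ∑' c, wt d ρ c := by
  have hg : Good d (code 0) := good_iff.2 ⟨by simpa [kdeg_code] using hd, by simp [ch_code]⟩
  refine hs.tsum_pos (wt_nonneg hρ.le) (code 0) ?_
  rw [wt_of_good hg]
  positivity

theorem exists_tilt_le {d : ℕ} (hd : 0 < d) {ρ : ℝ} (hρ : 0 < ρ) (hρ1 : ρ < 1)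
    (hs : Summable (wt d ρ)) {f : ℕ → ℕ → ℝ} {M : ℝ} (hM : ∀ i < d, ∀ j < d, |f i j| ≤ M) :
    ∃ r : ℝ, ∀ η : ℝ, 0 < η → ∀ᶠ θ in 𝓝 (0 : ℝ), ∃ C, ∀ N,
      ∑ c ∈ Finset.range N, tilt d ρ f r η θ c ≤ C := by
  have hM0 : 0 ≤ M := (abs_nonneg _).trans (hM 0 hd 0 hd)
  set p : ℕ → ℝ := fun k => ∑' c, wt d ρ c ^ k with hp
  have hpnn : ∀ k, 0 ≤ p k := fun k => tsum_nonneg fun c => pow_nonneg (wt_nonneg hρ.le c) k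
  have hp1 : p 1 = ∑' c, wt d ρ c := by simp [hp]
  have hppos : 0 < p 1 := hp1 ▸ tsum_wt_pos hd hρ hs
  have hapos : ∀ j < d, 0 < rootWt d ρ j := fun j hj =>
    (mul_pos hρ (homog_pos hpnn hppos j)).trans_le (homog_le_rootWt hρ hρ1 hs hj)
  -- the logarithmic derivatives of the summands
  set g : ℝ → ℕ → ℕ → ℝ := fun r j c => edgeSum f c - r * size c + f (kdeg c) j with hg
  have hgb : ∀ r, ∀ j < d, ∀ c, Good d c → |g r j c| ≤ (M + |r|) * size c := by
    intro r j hj c hc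
    have h1 := abs_edgeSum_le hM hc
    have h2 := hM _ (good_iff.1 hc).1 j hj
    have h3 := abs_add_le (edgeSum f c - r * size c) (f (kdeg c) j)
    have h4 := abs_sub (edgeSum f c) (r * size c)
    rw [abs_mul, Nat.abs_cast] at h4
    simp only [hg]
    linarith
  have hder : ∀ r, ∀ j < d, ∀ k : ℕ, 2 ≤ k →
      (Summable fun c => wt d ρ c ^ k * (k * g r j c)) ∧
        HasDerivAt (fun θ => ∑' c, wt d ρ c ^ k * Real.exp (θ * (k * g r j c)))
          (∑' c, wt d ρ c ^ k * (k * g r j c)) 0 := by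
    intro r j hj k hk
    obtain ⟨δ, hδ, h⟩ := exists_summable_wt_pow hρ hρ1 hs (hgb r j hj)
    exact hasDerivAt_tsum_exp (fun c => pow_nonneg (wt_nonneg hρ.le c) k) hδ (h k hk)
  have hsize : ∀ k : ℕ, 2 ≤ k → Summable fun c => wt d ρ c ^ k * (k * (size c : ℝ)) := by
    intro k hk
    obtain ⟨δ, hδ, h⟩ := exists_summable_wt_pow hρ hρ1 hs (g := fun c => (size c : ℝ)) (L := 1)
      (fun c _ => by simp)
    exact (hasDerivAt_tsum_exp (fun c => pow_nonneg (wt_nonneg hρ.le c) k) hδ (h k hk)).1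
  set q : ℕ → ℕ → ℝ := fun j k => if k = 1 then ∑ i ∈ Finset.range d, f i j * rootWt d ρ i
    else ∑' c, wt d ρ c ^ k * (k * g 0 j c) with hq
  set q' : ℕ → ℝ := fun k => if k = 1 then 0 else ∑' c, wt d ρ c ^ k * (k * (size c : ℝ)) with hq'
  set e : ℕ → ℝ := fun k => if k = 1 then 1 else 0 with he
  have hq'nn : ∀ k, 0 ≤ q' k := by
    intro k
    simp only [hq']
    split_ifs
    · exact le_rfl
    · exact tsum_nonneg fun c => mul_nonneg (pow_nonneg (wt_nonneg hρ.le c) k) (by positivity)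
  obtain ⟨r, b, hb⟩ := exists_slope hd hρ (e := e) q hpnn hq'nn
  refine ⟨r, fun η hη => ?_⟩
  set P : ℕ → ℝ → ℕ → ℝ := fun j θ k =>
    if k = 1 then ∑ i ∈ Finset.range d, Real.exp (θ * f i j) * (rootWt d ρ i + θ * b i)
    else ∑' c, wt d ρ c ^ k * Real.exp (θ * (k * g r j c)) with hP
  have hP0 : ∀ j, P j 0 = p := by
    intro j
    funext k
    simp only [hP]
    split_ifs with h
    · subst h
      simp [hp1, sum_rootWt hρ hs]
    · simp [hp]
  have hPder : ∀ j < d, ∀ k, 1 ≤ k → HasDerivAt (fun θ => P j θ k)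
      (q j k - r * q' k + (∑ j ∈ Finset.range d, b j) * e k) 0 := by
    intro j hj k hk
    rcases hk.eq_or_lt with rfl | hk
    · simp only [hP, hq, hq', he, if_true]
      have : ∀ i ∈ Finset.range d,
          HasDerivAt (fun θ : ℝ => Real.exp (θ * f i j) * (rootWt d ρ i + θ * b i))
            (f i j * rootWt d ρ i + b i) 0 := by
        intro i _
        have h1 := ((hasDerivAt_id (0 : ℝ)).mul_const (f i j)).exp
        have h2 := ((hasDerivAt_id (0 : ℝ)).mul_const (b i)).const_add (rootWt d ρ i)
        exact (h1.mul h2).congr_deriv (by simp)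
      exact (HasDerivAt.fun_sum this).congr_deriv (by rw [Finset.sum_add_distrib]; ring)
    · have hk1 : k ≠ 1 := by omega
      simp only [hP, hq, hq', he, if_neg hk1]
      refine (hder r j hj k hk).2.congr_deriv ?_
      rw [mul_zero, add_zero, ← tsum_mul_left,
        ← ((hder 0 j hj k hk).1.tsum_sub ((hsize k hk).mul_left r))]
      refine tsum_congr fun c => ?_
      simp only [hg]
      ring
  have hev : ∀ j ∈ Finset.range d, ∀ᶠ θ in 𝓝 (0 : ℝ), 0 ≤ rootWt d ρ j + θ * b j ∧
      Real.exp (-(η * |θ|)) * (ρ * (Real.exp (-r * θ) * homog (P j θ) j))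
        ≤ rootWt d ρ j + θ * b j := by
    intro j hj
    rw [Finset.mem_range] at hj
    refine eventually_exp_mul_le ?_ ?_ (hapos j hj) hη
    · have h1 := ((hasDerivAt_id (0 : ℝ)).const_mul (-r)).exp
      refine ((h1.mul (hasDerivAt_homog (hPder j hj) j)).const_mul ρ).congr_deriv ?_
      rw [hb j, hP0]
      simp
    · simpa [hP0] using homog_le_rootWt hρ hρ1 hs hj
  have hev' := (Finset.eventually_all _).2 hev
  have hsm : ∀ j ∈ Finset.range d, ∀ᶠ θ in 𝓝 (0 : ℝ), ∀ k : ℕ, 2 ≤ k →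
      Summable fun c => wt d ρ c ^ k * Real.exp (θ * (k * g r j c)) := by
    intro j hj
    obtain ⟨δ, hδ, h⟩ := exists_summable_wt_pow hρ hρ1 hs (hgb r j (Finset.mem_range.1 hj))
    filter_upwards [Metric.ball_mem_nhds (0 : ℝ) hδ] with θ hθ k hk
    rw [Metric.mem_ball, dist_zero_right, Real.norm_eq_abs] at hθ
    refine Summable.of_nonneg_of_le (fun c => mul_nonneg (pow_nonneg (wt_nonneg hρ.le c) k)
      (Real.exp_pos _).le) (fun c => ?_) (h k hk)
    refine mul_le_mul_of_nonneg_left (Real.exp_le_exp.2 ?_) (pow_nonneg (wt_nonneg hρ.le c) k)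
    calc θ * (k * g r j c) ≤ |θ * (k * g r j c)| := le_abs_self _
      _ = |θ| * |k * g r j c| := abs_mul _ _
      _ ≤ _ := by gcongr
  filter_upwards [hev', (Finset.eventually_all _).2 hsm] with θ h1 h2
  refine ⟨∑ j ∈ Finset.range d, (rootWt d ρ j + θ * b j), sum_tilt_le (P := fun j => P j θ) hρ.le
    (fun j hj => (h1 j (Finset.mem_range.2 hj)).1) (fun j hj => le_of_eq ?_)
    (fun j hj k hk s => ?_) (fun j hj => ?_)⟩
  · simp [hP]
  · have hk1 : k ≠ 1 := by omega
    simp only [hP, if_neg hk1]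
    have h3 := h2 j (Finset.mem_range.2 hj) k hk
    refine le_trans (Finset.sum_le_sum fun x _ => ?_) (h3.sum_le_tsum s fun c _ =>
      mul_nonneg (pow_nonneg (wt_nonneg hρ.le c) k) (Real.exp_pos _).le)
    rw [tilt, mul_assoc, ← Real.exp_add, mul_pow, ← Real.exp_nat_mul]
    refine mul_le_mul_of_nonneg_left (Real.exp_le_exp.2 ?_) (pow_nonneg (wt_nonneg hρ.le x) k)
    simp only [hg]
    have : 0 ≤ (k : ℝ) * (η * |θ| * size x) := by positivity
    linarith
  · refine le_trans (le_of_eq ?_) (h1 j (Finset.mem_range.2 hj)).2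
    rw [sub_eq_add_neg, Real.exp_add, neg_mul]
    ring

/-- The children of `v` in the tree with root `r` and parent function `up`. -/
noncomputable def kids {V : Type*} [Fintype V] [DecidableEq V] (r : V) (up : V → V) (v : V) : Finset V :=
  {x | x ≠ r ∧ up x = v}

lemma mem_kids {V : Type*} [Fintype V] [DecidableEq V] {r : V} {up : V → V} {v x : V} :
    x ∈ kids r up v ↔ x ≠ r ∧ up x = v := by
  simp [kids]

/-- `E` assigns to each vertex the code of the subtree of its descendants, with respect to the
root `r` and the parent function `up`. -/
def IsEnc {V : Type*} [Fintype V] [DecidableEq V] (r : V) (up : V → V) (E : V → ℕ) : Prop :=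
  ∀ v, ch (E v) = (kids r up v).val.map E

/-- The adjacency relation of the tree with root `r` and parent function `up`. -/
def IsAdj {V : Type*} (r : V) (up : V → V) (x y : V) : Prop :=
  (x ≠ r ∧ up x = y) ∨ (y ≠ r ∧ up y = x)

section Enc

variable {V : Type*} [Fintype V] [DecidableEq V] {r : V} {up : V → V} {E : V → ℕ}

lemma IsEnc.lt (h : IsEnc r up E) {x : V} (hx : x ≠ r) : E x < E (up x) := by
  apply lt_of_mem_ch
  rw [h]
  exact Multiset.mem_map_of_mem E (mem_kids.2 ⟨hx, rfl⟩)

lemma IsEnc.kdeg_eq (h : IsEnc r up E) (v : V) : kdeg (E v) = (kids r up v).card := by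
  rw [kdeg, h, Multiset.card_map, Finset.card_val]

lemma IsEnc.induction (h : IsEnc r up E) {P : V → Prop} (h0 : P r)
    (h1 : ∀ x, x ≠ r → P (up x) → P x) (x : V) : P x := by
  obtain ⟨B, hB⟩ : ∃ B, ∀ x, E x ≤ B :=
    ⟨Finset.univ.sup E, fun x => Finset.le_sup (f := E) (Finset.mem_univ x)⟩
  have key : ∀ k x, B < E x + k → P x := by
    intro k
    induction k with
    | zero => intro x hx; exact absurd (hB x) (by omega)
    | succ k ih =>
      intro x hx
      by_cases hr : x = r
      · exact hr ▸ h0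
      · exact h1 x hr (ih _ (by have := h.lt hr; omega))
  exact key (B + 1) x (by omega)

lemma IsEnc.exists_rec (h : IsEnc r up E) {W : Type*} (w : W) (F : V → W → W) :
    ∃ φ : V → W, φ r = w ∧ ∀ x, x ≠ r → φ x = F x (φ (up x)) := by
  obtain ⟨B, hB⟩ : ∃ B, ∀ x, E x ≤ B :=
    ⟨Finset.univ.sup E, fun x => Finset.le_sup (f := E) (Finset.mem_univ x)⟩
  let Φ : ℕ → V → W := fun k => Nat.rec (fun _ => w)
    (fun _ ψ x => if x = r then w else F x (ψ (up x))) k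
  have hΦ : ∀ k x, Φ (k + 1) x = if x = r then w else F x (Φ k (up x)) := fun _ _ => rfl
  have key : ∀ k x, B < E x + k → Φ k x = Φ (k + 1) x := by
    intro k
    induction k with
    | zero => intro x hx; exact absurd (hB x) (by omega)
    | succ k ih =>
      intro x hx
      rw [hΦ k, hΦ (k + 1)]
      split_ifs with hr
      · rfl
      · rw [ih _ (by have := h.lt hr; omega)]
  refine ⟨Φ (B + 1), by rw [hΦ, if_pos rfl], fun x hx => ?_⟩
  rw [key (B + 1) x (by omega), hΦ (B + 1), if_neg hx]

lemma sum_kids {M : Type*} [AddCommMonoid M] (F : V → V → M) :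
    ∑ v, ∑ x ∈ kids r up v, F x v = ∑ x with x ≠ r, F x (up x) := by
  rw [← Finset.sum_fiberwise {x | x ≠ r} up fun x => F x (up x)]
  refine Finset.sum_congr rfl fun v _ => ?_
  have : kids r up v = {x ∈ ({x | x ≠ r} : Finset V) | up x = v} := by
    ext x; simp [mem_kids]
  rw [this]
  exact Finset.sum_congr rfl fun x hx => by rw [(Finset.mem_filter.1 hx).2]

lemma IsEnc.sum_ch (h : IsEnc r up E) {M : Type*} [AddCommMonoid M] (F : ℕ → M) (v : V) :
    ((ch (E v)).map F).sum = ∑ x ∈ kids r up v, F (E x) := by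
  rw [h, Multiset.map_map]
  rfl

lemma IsEnc.fold_eq_sum (h : IsEnc r up E) {M : Type*} [AddCancelCommMonoid M] (φ : ℕ → M) :
    fold φ (E r) = ∑ v, φ (E v) := by
  have h1 : ∑ v, fold φ (E v) = ∑ v, φ (E v) + ∑ v with v ≠ r, fold φ (E v) := by
    rw [← sum_kids (up := up) (fun x _ => fold φ (E x)), ← Finset.sum_add_distrib]
    refine Finset.sum_congr rfl fun v _ => ?_
    rw [fold_eq, h.sum_ch]
  have h2 : ∑ v, fold φ (E v) = fold φ (E r) + ∑ v with v ≠ r, fold φ (E v) := by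
    rw [← Finset.sum_filter_add_sum_filter_not Finset.univ (fun v => v = r)]
    congr 1
    simp [Finset.filter_eq']
  exact add_right_cancel (h2.symm.trans h1)

lemma IsEnc.size_eq_card (h : IsEnc r up E) : size (E r) = Fintype.card V := by
  rw [size, h.fold_eq_sum]
  simp

lemma IsEnc.edgeSum_eq_sum (h : IsEnc r up E) (f : ℕ → ℕ → ℝ) :
    edgeSum f (E r) = ∑ x with x ≠ r, f (kdeg (E x)) (kdeg (E (up x))) := by
  rw [edgeSum, h.fold_eq_sum, ← sum_kids (up := up) (fun x v => f (kdeg (E x)) (kdeg (E v)))]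
  exact Finset.sum_congr rfl fun v _ => h.sum_ch (fun x => f (kdeg x) (kdeg (E v))) v

lemma IsEnc.good (h : IsEnc r up E) {d : ℕ} (hd : ∀ v, kdeg (E v) < d) (v : V) :
    Good d (E v) := by
  suffices ∀ c v, E v = c → Good d c from this _ v rfl
  intro c
  induction c using Nat.strong_induction_on with
  | _ c ih =>
    rintro v rfl
    refine good_iff.2 ⟨hd v, fun x hx => ?_⟩
    have hlt := lt_of_mem_ch hx
    rw [h, Multiset.mem_map] at hx
    obtain ⟨w, -, rfl⟩ := hx
    exact ih _ hlt w rfl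

lemma IsEnc.unique (h : IsEnc r up E) {up' : V → V} {E' : V → ℕ} (h' : IsEnc r up' E')
    (hadj : ∀ x y, IsAdj r up x y → IsAdj r up' x y) : E r = E' r := by
  have hup : ∀ x, x ≠ r → up x = up' x := by
    intro x
    refine h.induction (P := fun x => x ≠ r → up x = up' x) (fun h => absurd rfl h) ?_ x
    intro x hx ih _
    rcases hadj x (up x) (Or.inl ⟨hx, rfl⟩) with h1 | ⟨h1, h2⟩
    · exact h1.2.symm
    · rw [← ih h1] at h2
      have h3 := h.lt hx
      have h4 := h.lt h1
      rw [h2] at h4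
      omega
  have hk : ∀ v, kids r up v = kids r up' v := by
    intro v
    ext x
    rw [mem_kids, mem_kids]
    exact and_congr_right fun hx => by rw [hup x hx]
  suffices ∀ c v, E v = c → E v = E' v from this _ r rfl
  intro c
  induction c using Nat.strong_induction_on with
  | _ c ih =>
    rintro v rfl
    apply ch_injective
    rw [h, h', ← hk]
    refine Multiset.map_congr rfl fun x hx => ih _ ?_ x rfl
    obtain ⟨h1, rfl⟩ := mem_kids.1 hx
    exact h.lt h1

lemma IsEnc.map (h : IsEnc r up E) {W : Type*} [Fintype W] [DecidableEq W] (e : V ≃ W) :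
    IsEnc (e r) (fun x => e (up (e.symm x))) (fun x => E (e.symm x)) := by
  intro w
  have : kids (e r) (fun x => e (up (e.symm x))) w = (kids r up (e.symm w)).map e.toEmbedding := by
    ext x
    simp only [mem_kids, Finset.mem_map_equiv]
    rw [Ne, Ne, e.symm_apply_eq, Equiv.eq_symm_apply]
  rw [this, h, Finset.map_val, Multiset.map_map]
  exact Multiset.map_congr rfl fun x _ => by simp

end Enc

lemma exists_injOn_of_map_eq {V W : Type*} [DecidableEq V] [DecidableEq W] (w : W) {E : V → ℕ}
    {E' : W → ℕ} (A : Finset V) (B : Finset W) (h : A.val.map E = B.val.map E') :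
    ∃ σ : V → W, (∀ x ∈ A, σ x ∈ B ∧ E' (σ x) = E x) ∧ Set.InjOn σ A := by
  induction A using Finset.induction_on generalizing B with
  | empty => exact ⟨fun _ => w, by simp⟩
  | insert a A ha ih =>
    rw [Finset.insert_val_of_notMem ha, Multiset.map_cons] at h
    obtain ⟨b, hb, hab⟩ := Multiset.mem_map.1 (h ▸ Multiset.mem_cons_self (E a) _)
    rw [← Multiset.cons_erase hb, Multiset.map_cons, hab, Multiset.cons_inj_right,
      ← Finset.erase_val] at h
    obtain ⟨σ, h1, h2⟩ := ih _ h
    have hne : ∀ x ∈ A, x ≠ a := fun x hx hxa => ha (hxa ▸ hx)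
    have hσ : ∀ x ∈ A, Function.update σ a b x = σ x := fun x hx =>
      Function.update_of_ne (hne x hx) _ _
    have hσb : ∀ x ∈ A, σ x ≠ b := fun x hx => (Finset.mem_erase.1 (h1 x hx).1).1
    refine ⟨Function.update σ a b, ?_, ?_⟩
    · intro x hx
      rcases Finset.mem_insert.1 hx with rfl | hx
      · simpa using ⟨hb, hab⟩
      · rw [hσ x hx]
        exact ⟨Finset.mem_of_mem_erase (h1 x hx).1, (h1 x hx).2⟩
    · intro x hx y hy hxy
      rw [Finset.mem_coe, Finset.mem_insert] at hx hy
      rcases hx with rfl | hx <;> rcases hy with rfl | hy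
      · rfl
      · rw [hσ y hy, Function.update_self] at hxy
        exact absurd hxy.symm (hσb y hy)
      · rw [hσ x hx, Function.update_self] at hxy
        exact absurd hxy (hσb x hx)
      · rw [hσ x hx, hσ y hy] at hxy
        exact h2 hx hy hxy

lemma IsEnc.exists_equiv {V W : Type*} [Fintype V] [DecidableEq V] [Fintype W] [DecidableEq W]
    {r : V} {up : V → V} {E : V → ℕ} {r' : W} {up' : W → W} {E' : W → ℕ} (h : IsEnc r up E)
    (h' : IsEnc r' up' E') (hr : E r = E' r') :
    ∃ e : V ≃ W, ∀ x y, IsAdj r up x y ↔ IsAdj r' up' (e x) (e y) := by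
  have h0 : ∀ v w, ∃ σ : V → W, E v = E' w →
      (∀ x ∈ kids r up v, σ x ∈ kids r' up' w ∧ E' (σ x) = E x) ∧ Set.InjOn σ (kids r up v) := by
    intro v w
    by_cases hvw : E v = E' w
    · obtain ⟨σ, hσ⟩ := exists_injOn_of_map_eq w (E := E) (E' := E') (kids r up v)
        (kids r' up' w) (by rw [← h, ← h', hvw])
      exact ⟨σ, fun _ => hσ⟩
    · exact ⟨fun _ => w, fun h => absurd h hvw⟩
  choose τ hτ using h0
  obtain ⟨φ, hφr, hφ⟩ := h.exists_rec r' fun x w => τ (up x) w x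
  have hE : ∀ x, E x = E' (φ x) := by
    refine h.induction (by rw [hφr, hr]) fun x hx ih => ?_
    rw [hφ x hx]
    exact ((hτ _ _ ih).1 x (mem_kids.2 ⟨hx, rfl⟩)).2.symm
  have hφk : ∀ x, x ≠ r → φ x ≠ r' ∧ up' (φ x) = φ (up x) := by
    intro x hx
    rw [hφ x hx]
    exact mem_kids.1 ((hτ _ _ (hE (up x))).1 x (mem_kids.2 ⟨hx, rfl⟩)).1
  have hinj : Function.Injective φ := by
    intro x
    refine h.induction (P := fun x => ∀ ⦃y⦄, φ x = φ y → x = y) ?_ ?_ x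
    · intro y hy
      by_contra hne
      exact (hφk y (Ne.symm hne)).1 (by rw [← hy, hφr])
    · intro x hx ih y hy
      have hyr : y ≠ r := by
        rintro rfl
        exact (hφk x hx).1 (by rw [hy, hφr])
      have hup : up x = up y := ih (by rw [← (hφk x hx).2, ← (hφk y hyr).2, hy])
      rw [hφ x hx, hφ y hyr, ← hup] at hy
      exact (hτ _ _ (hE (up x))).2 (mem_kids.2 ⟨hx, rfl⟩) (mem_kids.2 ⟨hyr, hup.symm⟩) hy
  have hcard : Fintype.card V = Fintype.card W := by rw [← h.size_eq_card, ← h'.size_eq_card, hr]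
  have hne : ∀ x, x ≠ r ↔ φ x ≠ r' := fun x =>
    ⟨fun hx => (hφk x hx).1, fun hx hxr => hx (hxr ▸ hφr)⟩
  refine ⟨Equiv.ofBijective φ ((Fintype.bijective_iff_injective_and_card φ).2 ⟨hinj, hcard⟩),
    fun x y => ?_⟩
  have key : ∀ x y, (x ≠ r ∧ up x = y) ↔ (φ x ≠ r' ∧ up' (φ x) = φ y) := by
    intro x y
    rw [← hne]
    exact and_congr_right fun hx => by rw [(hφk x hx).2, hinj.eq_iff]
  exact or_congr (key x y) (key y x)

/-- The parent function of the tree obtained from two trees by attaching the second one to the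
root of the first one. -/
def joinUp {V W : Type*} [DecidableEq W] (r : V) (up : V → V) (s : W) (vp : W → W) :
    V ⊕ W → V ⊕ W
  | .inl v => .inl (up v)
  | .inr w => if w = s then .inl r else .inr (vp w)

lemma IsEnc.join {V W : Type*} [Fintype V] [DecidableEq V] [Fintype W] [DecidableEq W]
    {r : V} {up : V → V} {E : V → ℕ} {s : W} {vp : W → W} {F : W → ℕ} (h : IsEnc r up E)
    (h' : IsEnc s vp F) :
    IsEnc (Sum.inl r) (joinUp r up s vp)
      (Sum.elim (fun v => if v = r then code (F s ::ₘ ch (E r)) else E v) F) := by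
  have hl : ∀ v, (kids r up v).val.map
      (fun v => if v = r then code (F s ::ₘ ch (E r)) else E v) = (kids r up v).val.map E :=
    fun v => Multiset.map_congr rfl fun x hx => if_neg (mem_kids.1 hx).1
  rintro (v | w)
  · by_cases hv : v = r
    · subst hv
      have : kids (Sum.inl v) (joinUp v up s vp) (Sum.inl v)
          = Finset.cons (Sum.inr s) ((kids v up v).map Function.Embedding.inl) (by simp) := by
        ext (x | x)
        · simp [mem_kids, joinUp]
        · simp [mem_kids, joinUp]
      rw [this]
      simpa [ch_code, Multiset.map_map, Function.comp_def] using (h v).trans (hl v).symm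
    · have : kids (Sum.inl r) (joinUp r up s vp) (Sum.inl v)
          = (kids r up v).map Function.Embedding.inl := by
        ext (x | x)
        · simp [mem_kids, joinUp]
        · by_cases hx : x = s <;> simp [mem_kids, joinUp, hx, Ne.symm hv]
      rw [this]
      simp [hv, h v, hl, Multiset.map_map, Function.comp_def]
  · have : kids (Sum.inl r) (joinUp r up s vp) (Sum.inr w)
        = (kids s vp w).map Function.Embedding.inr := by
      ext (x | x)
      · simp [mem_kids, joinUp]
      · by_cases hx : x = s <;> simp [mem_kids, joinUp, hx]
    rw [this]
    simp [h' w, Multiset.map_map, Function.comp_def]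

lemma exists_isEnc (c : ℕ) : ∃ (V : Type) (_ : Fintype V) (_ : DecidableEq V) (r : V)
    (up : V → V) (E : V → ℕ), IsEnc r up E ∧ E r = c := by
  induction c using Nat.strong_induction_on with
  | _ c ih =>
    suffices ∀ m : Multiset ℕ, (∀ x ∈ m, x < c) → ∃ (V : Type) (_ : Fintype V)
        (_ : DecidableEq V) (r : V) (up : V → V) (E : V → ℕ), IsEnc r up E ∧ E r = code m by
      simpa [code_ch] using this (ch c) fun x hx => lt_of_mem_ch hx
    intro m
    induction m using Multiset.induction with
    | empty =>
      refine fun _ => ⟨Unit, inferInstance, inferInstance, (), id, fun _ => code 0, ?_, rfl⟩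
      intro v
      have : kids () id v = ∅ := by
        ext x
        simp [mem_kids]
      simp [this, ch_code]
    | cons a m ihm =>
      intro hm
      obtain ⟨V, _, _, r, up, E, h, hr⟩ := ihm fun x hx => hm x (Multiset.mem_cons_of_mem hx)
      obtain ⟨W, _, _, s, vp, F, h', hs⟩ := ih a (hm a (Multiset.mem_cons_self a m))
      exact ⟨V ⊕ W, inferInstance, inferInstance, _, _, _, h.join h', by simp [hr, hs, ch_code]⟩

section Graph

variable {V : Type*} [Fintype V] [DecidableEq V] {r : V} {up : V → V} {E : V → ℕ}

lemma IsEnc.exists_graph (h : IsEnc r up E) :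
    ∃ G : SimpleGraph V, ∀ x y, G.Adj x y ↔ IsAdj r up x y := by
  refine ⟨⟨IsAdj r up, ⟨fun x y => Or.symm⟩, ⟨fun x => ?_⟩⟩, fun x y => Iff.rfl⟩
  rintro (⟨h1, h2⟩ | ⟨h1, h2⟩) <;>
  · have := h.lt h1
    rw [h2] at this
    omega

variable {G : SimpleGraph V}

/-- The edge joining a vertex other than the root to its parent. -/
def parentEdge (hG : ∀ x y, G.Adj x y ↔ IsAdj r up x y) (x : {x // x ≠ r}) : G.edgeSet :=
  ⟨s(x.1, up x.1), (hG _ _).2 (Or.inl ⟨x.2, rfl⟩)⟩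

lemma IsEnc.bijective_parentEdge (h : IsEnc r up E) (hG : ∀ x y, G.Adj x y ↔ IsAdj r up x y) :
    Function.Bijective (parentEdge hG) := by
  constructor
  · rintro ⟨x, hx⟩ ⟨y, hy⟩ hxy
    rcases Sym2.eq_iff.1 (Subtype.ext_iff.1 hxy) with ⟨h1, -⟩ | ⟨h1, h2⟩
    · exact Subtype.ext h1
    · have h3 := h.lt hx
      have h4 := h.lt hy
      simp only at h1 h2
      rw [h2] at h3
      rw [← h1] at h4
      omega
  · rintro ⟨e, he⟩
    induction e using Sym2.ind with
    | _ x y =>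
      rcases (hG x y).1 he with ⟨h1, rfl⟩ | ⟨h1, rfl⟩
      · exact ⟨⟨x, h1⟩, rfl⟩
      · exact ⟨⟨y, h1⟩, Subtype.ext Sym2.eq_swap⟩

lemma IsEnc.isTree (h : IsEnc r up E) (hG : ∀ x y, G.Adj x y ↔ IsAdj r up x y) : G.IsTree := by
  have hr : ∀ x, G.Reachable x r := h.induction (SimpleGraph.Reachable.refl r)
    fun x hx ih => (SimpleGraph.Adj.reachable ((hG _ _).2 (Or.inl ⟨hx, rfl⟩))).trans ih
  rw [SimpleGraph.isTree_iff_connected_and_card]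
  refine ⟨(SimpleGraph.connected_iff_exists_forall_reachable G).2 ⟨r, fun x => (hr x).symm⟩, ?_⟩
  rw [← Nat.card_congr (Equiv.ofBijective _ (h.bijective_parentEdge hG)),
    Nat.card_eq_fintype_card, Nat.card_eq_fintype_card, Fintype.card_subtype_compl,
    Fintype.card_subtype_eq]
  exact Nat.sub_add_cancel (Fintype.card_pos_iff.2 ⟨r⟩)

lemma IsEnc.card_adj (h : IsEnc r up E) (hG : ∀ x y, G.Adj x y ↔ IsAdj r up x y) (v : V) :
    Nat.card {u // G.Adj v u} = kdeg (E v) + if v = r then 0 else 1 := by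
  classical
  rw [Nat.card_eq_fintype_card, Fintype.card_subtype, h.kdeg_eq]
  split_ifs with hv
  · congr 1
    ext x
    simp [hG, IsAdj, hv, mem_kids]
  · have hmem : up v ∉ kids r up v := by
      intro hmem
      obtain ⟨h1, h2⟩ := mem_kids.1 hmem
      have h3 := h.lt h1
      have h4 := h.lt hv
      rw [h2] at h3
      omega
    rw [← Finset.card_cons hmem]
    congr 1
    ext x
    simp [hG, IsAdj, hv, mem_kids, eq_comm]

lemma exists_enc_of_rank (d : V → ℕ) (hd : ∀ x, x ≠ r → d x = d (up x) + 1) :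
    ∃ E, IsEnc r up E := by
  obtain ⟨B, hB⟩ : ∃ B, ∀ x, d x ≤ B :=
    ⟨Finset.univ.sup d, fun x => Finset.le_sup (f := d) (Finset.mem_univ x)⟩
  let e : ℕ → V → ℕ := fun k => Nat.rec (fun _ => 0)
    (fun _ E v => code ((kids r up v).val.map E)) k
  have he : ∀ k v, e (k + 1) v = code ((kids r up v).val.map (e k)) := fun _ _ => rfl
  have key : ∀ k v, B < d v + k → e k v = e (k + 1) v := by
    intro k
    induction k with
    | zero => intro v hv; exact absurd (hB v) (by omega)
    | succ k ih =>
      intro v hv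
      rw [he k, he (k + 1)]
      congr 1
      refine Multiset.map_congr rfl fun x hx => ih x ?_
      obtain ⟨h1, rfl⟩ := mem_kids.1 hx
      rw [hd x h1]
      omega
  refine ⟨e (B + 1), fun v => ?_⟩
  rw [key (B + 1) v (by omega), he (B + 1), ch_code]

lemma exists_isEnc_of_isTree (hG : G.IsTree) (r : V) :
    ∃ up E, IsEnc r up E ∧ ∀ x y, G.Adj x y ↔ IsAdj r up x y := by
  have h1 : ∀ x, ∃ y, x ≠ r → G.Adj x y ∧ G.dist r x = G.dist r y + 1 := by
    intro x
    by_cases hx : x = r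
    · exact ⟨x, fun h => absurd hx h⟩
    · obtain ⟨p, hp⟩ := hG.connected.exists_walk_length_eq_dist x r
      cases p with
      | nil => exact absurd rfl hx
      | cons hadj q =>
        refine ⟨_, fun _ => ⟨hadj, ?_⟩⟩
        have h2 := SimpleGraph.dist_le q
        rw [SimpleGraph.Walk.length_cons] at hp
        have h3 := hG.dist_eq_dist_add_one_of_adj r hadj
        rw [SimpleGraph.dist_comm (u := r), SimpleGraph.dist_comm (u := r)] at h3 ⊢
        omega
  choose up hup using h1
  obtain ⟨E, hE⟩ := exists_enc_of_rank (r := r) (up := up) (G.dist r) fun x hx => (hup x hx).2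
  refine ⟨up, E, hE, ?_⟩
  obtain ⟨H, hH⟩ := hE.exists_graph
  have hle : H ≤ G := by
    intro x y hxy
    rcases (hH x y).1 hxy with ⟨hx, rfl⟩ | ⟨hy, rfl⟩
    · exact (hup x hx).1
    · exact (hup y hy).1.symm
  have h2 := (SimpleGraph.isTree_iff_connected_and_card.1 hG).2
  have h3 := (SimpleGraph.isTree_iff_connected_and_card.1 (hE.isTree hH)).2
  have h4 : H.edgeSet = G.edgeSet := by
    refine Set.eq_of_subset_of_ncard_le (SimpleGraph.edgeSet_mono hle) ?_ (Set.toFinite _)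
    rw [← Nat.card_coe_set_eq, ← Nat.card_coe_set_eq]
    omega
  rw [← SimpleGraph.edgeSet_inj.1 h4]
  exact hH

end Graph

lemma randic_eq {n : ℕ} {β : ℝ} {G : SimpleGraph (Fin n)} {r : Fin n} {up : Fin n → Fin n}
    {E : Fin n → ℕ} (h : IsEnc r up E) (hG : ∀ x y, G.Adj x y ↔ IsAdj r up x y) :
    randic β G = ∑ x with x ≠ r, ((degr G x : ℝ) * (degr G (up x) : ℝ)) ^ β := by
  rw [randic, ← finsum_comp_equiv (Equiv.ofBijective _ (h.bijective_parentEdge hG)),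
    finsum_eq_sum_of_fintype]
  exact (Finset.sum_subtype (p := fun x => x ≠ r) _ (by simp)
    fun x => ((degr G x : ℝ) * (degr G (up x) : ℝ)) ^ β).symm

/-- The summand of the Randić index in terms of the out-degrees of the two vertices. -/
noncomputable def randicToll (β : ℝ) (i j : ℕ) : ℝ := (((i : ℝ) + 1) * ((j : ℝ) + 1)) ^ β

lemma rpow_mul_le {Δ a b : ℝ} (ha : 1 ≤ a) (haΔ : a ≤ Δ) (hb : 1 ≤ b) (hbΔ : b ≤ Δ) (β : ℝ) :
    (a * b) ^ β ≤ (Δ * Δ) ^ |β| := by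
  have hab : 1 ≤ a * b := one_le_mul_of_one_le_of_one_le ha hb
  calc (a * b) ^ β ≤ (a * b) ^ |β| := Real.rpow_le_rpow_of_exponent_le hab (le_abs_self β)
    _ ≤ _ := Real.rpow_le_rpow (by linarith) (by gcongr; linarith) (abs_nonneg β)

lemma abs_randicToll_le {Δ : ℕ} (β : ℝ) {i j : ℕ} (hi : i < Δ) (hj : j < Δ) :
    |randicToll β i j| ≤ ((Δ : ℝ) * Δ) ^ |β| := by
  rw [randicToll, abs_of_nonneg (Real.rpow_nonneg (by positivity) β)]
  exact rpow_mul_le (by linarith [Nat.cast_nonneg (α := ℝ) i]) (by exact_mod_cast hi)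
    (by linarith [Nat.cast_nonneg (α := ℝ) j]) (by exact_mod_cast hj) β

lemma abs_randic_sub_le {n Δ : ℕ} {β : ℝ} {G : SimpleGraph (Fin n)} {r : Fin n}
    {up : Fin n → Fin n} {E : Fin n → ℕ} (h : IsEnc r up E)
    (hG : ∀ x y, G.Adj x y ↔ IsAdj r up x y) (hk : ∀ v, kdeg (E v) < Δ) :
    |randic β G - edgeSum (randicToll β) (E r)| ≤ Δ * ((Δ : ℝ) * Δ) ^ |β| := by
  set M := ((Δ : ℝ) * Δ) ^ |β| with hM
  have hMnn : 0 ≤ M := by positivity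
  have hdeg : ∀ v, v ≠ r → degr G v = kdeg (E v) + 1 := fun v hv => by
    rw [degr, h.card_adj hG, if_neg hv]
  have hdegr : degr G r = kdeg (E r) := by rw [degr, h.card_adj hG, if_pos rfl, add_zero]
  have hterm : ∀ x, x ≠ r → |((degr G x : ℝ) * (degr G (up x) : ℝ)) ^ β
      - randicToll β (kdeg (E x)) (kdeg (E (up x)))| ≤ if up x = r then M else 0 := by
    intro x hx
    split_ifs with hxr
    · have h1 := abs_randicToll_le β (hk x) (hk (up x))
      have h2 : ((degr G x : ℝ) * (degr G (up x) : ℝ)) ^ β ≤ M := by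
        have h3 : 0 < kdeg (E r) := by
          rw [h.kdeg_eq]
          exact Finset.card_pos.2 ⟨x, mem_kids.2 ⟨hx, hxr⟩⟩
        rw [hdeg x hx, hxr, hdegr]
        exact rpow_mul_le (by simp) (by exact_mod_cast hk x) (by exact_mod_cast h3)
          (by exact_mod_cast (hk r).le) β
      have h4 : 0 ≤ ((degr G x : ℝ) * (degr G (up x) : ℝ)) ^ β := Real.rpow_nonneg (by positivity) β
      have h5 : 0 ≤ randicToll β (kdeg (E x)) (kdeg (E (up x))) :=
        Real.rpow_nonneg (by positivity) β
      rw [abs_of_nonneg h5] at h1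
      rw [abs_le]
      constructor <;> linarith
    · rw [hdeg x hx, hdeg _ hxr, randicToll]
      simp
  rw [randic_eq h hG, h.edgeSum_eq_sum, ← Finset.sum_sub_distrib]
  calc _ ≤ ∑ x with x ≠ r, (if up x = r then M else 0) :=
        (Finset.abs_sum_le_sum_abs _ _).trans
          (Finset.sum_le_sum fun x hx => hterm x (Finset.mem_filter.1 hx).2)
    _ = kdeg (E r) * M := by
        rw [← Finset.sum_filter, Finset.sum_const, nsmul_eq_mul, Finset.filter_filter, h.kdeg_eq]
        rfl
    _ ≤ Δ * M := by
        gcongr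
        exact (hk r).le

lemma DTree.exists_enc {Δ n : ℕ} (hΔ : 2 ≤ Δ) (hn : 2 ≤ n) (T : DTree Δ n) :
    ∃ r up E, IsEnc r up E ∧ (∀ x y, T.1.Adj x y ↔ IsAdj r up x y) ∧ ∀ v, kdeg (E v) < Δ := by
  classical
  have : Nontrivial (Fin n) := Fin.nontrivial_iff_two_le.2 hn
  obtain ⟨r, hr⟩ := T.2.1.exists_vert_degree_one_of_nontrivial
  obtain ⟨up, E, h, hG⟩ := exists_isEnc_of_isTree T.2.1 r
  refine ⟨r, up, E, h, hG, fun v => ?_⟩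
  have h1 := h.card_adj hG v
  by_cases hv : v = r
  · subst hv
    have h2 : Nat.card {u // T.1.Adj v u} = T.1.degree v := by
      rw [Nat.card_eq_fintype_card, Fintype.card_subtype, ← SimpleGraph.card_neighborFinset_eq_degree]
      congr 1
      ext x
      simp
    rw [if_pos rfl] at h1
    omega
  · have h2 : Nat.card {u // T.1.Adj v u} ≤ Δ := T.2.2 v
    rw [if_neg hv] at h1
    omega

lemma exists_injective_trees {Δ n : ℕ} (hΔ : 2 ≤ Δ) (hn : 2 ≤ n) (β : ℝ) :
    ∃ F : TClass Δ n → ℕ, Function.Injective F ∧ ∀ c, F c ∈ trees Δ n ∧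
      |randic β (Quotient.out c).1 - edgeSum (randicToll β) (F c)|
        ≤ Δ * ((Δ : ℝ) * Δ) ^ |β| := by
  choose r up E h hG hk using fun c : TClass Δ n => (Quotient.out c).exists_enc hΔ hn
  refine ⟨fun c => E c (r c), fun c c' hc => ?_, fun c => ⟨mem_trees.2 ⟨(h c).good (hk c) _, ?_⟩,
    abs_randic_sub_le (h c) (hG c) (hk c)⟩⟩
  · obtain ⟨e, he⟩ := (h c).exists_equiv (h c') hc
    rw [← Quotient.out_equiv_out]
    exact ⟨⟨e, fun {x y} => by rw [hG c, hG c', he]⟩⟩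
  · rw [(h c).size_eq_card, Fintype.card_fin]

lemma isAdj_map {V W : Type*} (e : V ≃ W) {r : V} {up : V → V} (x y : W) :
    IsAdj (e r) (fun x => e (up (e.symm x))) x y ↔ IsAdj r up (e.symm x) (e.symm y) := by
  simp [IsAdj, Equiv.symm_apply_eq, Equiv.eq_symm_apply]

lemma IsEnc.good_of_good_root {V : Type*} [Fintype V] [DecidableEq V] {r : V} {up : V → V}
    {E : V → ℕ} (h : IsEnc r up E) {d : ℕ} (hr : Good d (E r)) (v : V) : Good d (E v) := by
  refine h.induction hr (fun x hx ih => (good_iff.1 ih).2 _ ?_) v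
  rw [h]
  exact Multiset.mem_map_of_mem E (mem_kids.2 ⟨hx, rfl⟩)

lemma exists_enc_out {Δ n u : ℕ} (hu : u ∈ trees Δ n) :
    ∃ (c : TClass Δ n) (r : Fin n) (up : Fin n → Fin n) (E : Fin n → ℕ), IsEnc r up E ∧
      (∀ x y, (Quotient.out c).1.Adj x y ↔ IsAdj r up x y) ∧ E r = u := by
  obtain ⟨hgood, hsize⟩ := mem_trees.1 hu
  obtain ⟨V, _, _, r, up, E, h, hr⟩ := exists_isEnc u
  have hcard : Fintype.card V = n := by rw [← h.size_eq_card, hr, hsize]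
  have h' := h.map (Fintype.equivFinOfCardEq hcard)
  set e := Fintype.equivFinOfCardEq hcard
  obtain ⟨G, hG⟩ := h'.exists_graph
  have hdeg : ∀ v, degr G v ≤ Δ := by
    intro v
    have h1 := (good_iff.1 (h.good_of_good_root (hr ▸ hgood) (e.symm v))).1
    have h2 := h'.card_adj hG v
    rw [degr, h2]
    split_ifs <;> omega
  let T : DTree Δ n := ⟨G, h'.isTree hG, hdeg⟩
  obtain ⟨φ⟩ : Nonempty (G ≃g (Quotient.out (⟦T⟧ : TClass Δ n)).1) :=
    Setoid.symm (Quotient.mk_out T)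
  refine ⟨⟦T⟧, _, _, _, h'.map φ.toEquiv, fun x y => ?_, ?_⟩
  · exact φ.symm.map_adj_iff.symm.trans ((hG _ _).trans (isAdj_map φ.toEquiv x y).symm)
  · change E (e.symm (φ.symm (φ (e r)))) = u
    rw [φ.symm_apply_apply, e.symm_apply_apply, hr]

lemma card_trees_le (Δ n : ℕ) : (trees Δ n).card ≤ n * Nat.card (TClass Δ n) := by
  choose c r up E h hG hu using fun u : trees Δ n => exists_enc_out u.2
  have hinj : Function.Injective fun u : trees Δ n => (r u, c u) := by
    intro u u' huu
    obtain ⟨h1, h2⟩ := Prod.mk.inj huu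
    have h3 := h u
    have hG3 := hG u
    rw [h1] at h3 hG3
    rw [h2] at hG3
    have := h3.unique (h u') fun x y hxy => (hG u' x y).1 ((hG3 x y).2 hxy)
    rw [hu u', ← h1, hu u] at this
    exact Subtype.ext this
  have := Nat.card_le_card_of_injective _ hinj
  rwa [Nat.card_prod, Nat.card_fin, Nat.card_eq_fintype_card, Fintype.card_coe] at this

lemma card_mul_exp_le {d : ℕ} {ρ : ℝ} (hρ : 0 ≤ ρ) {f : ℕ → ℕ → ℝ} {r η θ C a : ℝ}
    (hC : ∀ N, ∑ c ∈ Finset.range N, tilt d ρ f r η θ c ≤ C) {n : ℕ} {T : Finset ℕ}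
    (hT : T ⊆ trees d n) (hdev : ∀ c ∈ T, |θ| * (a * n) ≤ θ * (edgeSum f c - r * n)) :
    T.card * (ρ ^ n * Real.exp (|θ| * (a - η) * n)) ≤ C := by
  obtain ⟨N, hN⟩ := T.exists_nat_subset_range
  refine le_trans ?_ ((Finset.sum_le_sum_of_subset_of_nonneg hN fun c _ _ =>
    tilt_nonneg hρ f r η θ c).trans (hC N))
  rw [← nsmul_eq_mul]
  refine Finset.card_nsmul_le_sum _ _ _ fun c hc => ?_
  obtain ⟨h1, h2⟩ := mem_trees.1 (hT hc)
  have h3 := hdev c hc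
  rw [tilt, wt_of_good h1, h2]
  refine mul_le_mul_of_nonneg_left (Real.exp_le_exp.2 ?_) (pow_nonneg hρ n)
  linarith

lemma exists_card_deviation_le {d : ℕ} (hd : 0 < d) {ρ : ℝ} (hρ : 0 < ρ) (hρ1 : ρ < 1)
    (hs : Summable (wt d ρ)) {f : ℕ → ℕ → ℝ} {M : ℝ} (hM : ∀ i < d, ∀ j < d, |f i j| ≤ M) :
    ∃ r : ℝ, ∀ ε : ℝ, 0 < ε → ∃ C a : ℝ, 0 < a ∧ ∀ n : ℕ,
      ({c ∈ trees d n | ε * n < |edgeSum f c - r * n|}.card : ℝ) * (ρ ^ n * Real.exp (a * n))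
        ≤ C := by
  obtain ⟨r, hr⟩ := exists_tilt_le hd hρ hρ1 hs hM
  refine ⟨r, fun ε hε => ?_⟩
  have h1 := hr (ε / 2) (by positivity)
  have h2 : ∀ᶠ θ in 𝓝 (0 : ℝ), ∃ C, ∀ N,
      ∑ c ∈ Finset.range N, tilt d ρ f r (ε / 2) (-θ) c ≤ C := by
    have : Tendsto (fun θ : ℝ => -θ) (𝓝 0) (𝓝 0) := by simpa using (continuous_neg (G := ℝ)).tendsto 0
    exact this.eventually h1
  have h3 : ∀ᶠ θ in 𝓝[>] (0 : ℝ), _ := (h1.and h2).filter_mono nhdsWithin_le_nhds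
  obtain ⟨θ, ⟨⟨C₁, hC₁⟩, ⟨C₂, hC₂⟩⟩, hθ⟩ := (h3.and self_mem_nhdsWithin).exists
  refine ⟨C₁ + C₂, θ * (ε - ε / 2), mul_pos hθ (by linarith), fun n => ?_⟩
  have hsub : {c ∈ trees d n | ε * n < |edgeSum f c - r * n|}
      ⊆ {c ∈ trees d n | ε * n ≤ edgeSum f c - r * n} ∪
        {c ∈ trees d n | ε * n ≤ -(edgeSum f c - r * n)} := by
    intro c hc
    rw [Finset.mem_filter] at hc
    rw [Finset.mem_union, Finset.mem_filter, Finset.mem_filter]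
    rcases lt_abs.1 hc.2 with h | h
    · exact Or.inl ⟨hc.1, h.le⟩
    · exact Or.inr ⟨hc.1, h.le⟩
  have hcard := (Finset.card_le_card hsub).trans (Finset.card_union_le _ _)
  have k1 := card_mul_exp_le (a := ε) hρ.le hC₁
    (Finset.filter_subset (fun c => ε * n ≤ edgeSum f c - r * n) (trees d n)) fun c hc => by
      rw [abs_of_pos hθ]
      exact mul_le_mul_of_nonneg_left (Finset.mem_filter.1 hc).2 hθ.le
  have k2 := card_mul_exp_le (a := ε) hρ.le hC₂
    (Finset.filter_subset (fun c => ε * n ≤ -(edgeSum f c - r * n)) (trees d n)) fun c hc => by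
      rw [abs_neg, abs_of_pos hθ, neg_mul_comm]
      exact mul_le_mul_of_nonneg_left (Finset.mem_filter.1 hc).2 hθ.le
  rw [abs_of_pos hθ] at k1
  rw [abs_neg, abs_of_pos hθ] at k2
  refine le_trans ?_ (add_le_add k1 k2)
  rw [← add_mul]
  exact mul_le_mul_of_nonneg_right (by exact_mod_cast hcard) (by positivity)

lemma prob_eq_one_sub {Δ n : ℕ} (h : 0 < Nat.card (TClass Δ n)) (P : TClass Δ n → Prop) :
    prob Δ n P = 1 - Nat.card {c : TClass Δ n // ¬ P c} / Nat.card (TClass Δ n) := by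
  classical
  have h1 : Nat.card {c : TClass Δ n // P c} + Nat.card {c : TClass Δ n // ¬ P c}
      = Nat.card (TClass Δ n) := by
    rw [← Nat.card_sum, Nat.card_congr (Equiv.sumCompl P)]
  have h2 : (0 : ℝ) < Nat.card (TClass Δ n) := by exact_mod_cast h
  rw [prob, eq_sub_iff_add_eq, ← add_div, div_eq_one_iff_eq h2.ne']
  exact_mod_cast h1

lemma card_bad_le {Δ n : ℕ} (hΔ : 2 ≤ Δ) (hn : 2 ≤ n) {β r ε : ℝ}
    (hK : Δ * ((Δ : ℝ) * Δ) ^ |β| ≤ ε / 2 * n) :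
    Nat.card {c : TClass Δ n // ¬ |randic β (Quotient.out c).1 - r * n| ≤ ε * n}
      ≤ {u ∈ trees Δ n | ε / 2 * n < |edgeSum (randicToll β) u - r * n|}.card := by
  obtain ⟨F, hinj, hF⟩ := exists_injective_trees hΔ hn β
  rw [← Fintype.card_coe, ← Nat.card_eq_fintype_card]
  refine Nat.card_le_card_of_injective (fun c => ⟨F c.1, Finset.mem_filter.2 ⟨(hF c.1).1, ?_⟩⟩)
    fun c c' hcc => Subtype.ext (hinj (Subtype.ext_iff.1 hcc))
  have h1 := c.2
  have h2 := (hF c.1).2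
  have h3 := abs_add_le (randic β (Quotient.out c.1).1 - edgeSum (randicToll β) (F c.1))
    (edgeSum (randicToll β) (F c.1) - r * n)
  rw [sub_add_sub_cancel] at h3
  rw [not_le] at h1
  linarith

/-- For `3 ≤ Δ` and a real exponent `β`, there is a constant `r_β` such that
for every `ε > 0`, the probability that the general Randić index of a uniformly random
isomorphism class of `Δ`-trees of order `n` differs from `r_β·n` by at most `ε·n` tends to `1`. -/
theorem randic_concentration (Δ : ℕ) (hΔ : 3 ≤ Δ) (β : ℝ) :
    ∃ r : ℝ, ∀ ε : ℝ, 0 < ε →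
      Tendsto
        (fun n : ℕ => prob Δ n (fun c => |randic β (Quotient.out c).1 - r * n| ≤ ε * n))
        atTop (𝓝 1) := by
  obtain ⟨ρ, hρ, hρ1, hcard, hlow⟩ := exists_radius hΔ
  obtain ⟨r, hr⟩ := exists_card_deviation_le (by omega) hρ hρ1 (summable_wt hΔ hρ hcard)
    (f := randicToll β) fun i hi j hj => abs_randicToll_le β hi hj
  refine ⟨r, fun ε hε => ?_⟩
  obtain ⟨C, a, ha, hC⟩ := hr (ε / 2) (by positivity)
  have hlim : Tendsto (fun n : ℕ => 1 - C * (n * Real.exp (-(a / 2)) ^ n)) atTop (𝓝 1) := by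
    have := (tendsto_self_mul_const_pow_of_lt_one (Real.exp_pos (-(a / 2))).le
      (by simpa using ha)).const_mul C
    simpa using this.const_sub 1
  have hK : ∀ᶠ n : ℕ in atTop, Δ * ((Δ : ℝ) * Δ) ^ |β| ≤ ε / 2 * n :=
    (tendsto_natCast_atTop_atTop.const_mul_atTop (by positivity)).eventually_ge_atTop _
  have hpos : ∀ n, 1 ≤ n → 0 < Nat.card (TClass Δ n) := fun n hn =>
    Nat.pos_of_ne_zero fun h => by
      have h1 := card_trees_le Δ n
      have h2 := card_trees_pos (d := Δ) (by omega) hn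
      rw [h, mul_zero] at h1
      omega
  refine tendsto_of_tendsto_of_tendsto_of_le_of_le' hlim tendsto_const_nhds ?_ ?_
  · filter_upwards [hK, hlow (a / 2) (by positivity), eventually_ge_atTop 2] with n h1 h2 hn
    rw [prob_eq_one_sub (hpos n (by omega))]
    refine sub_le_sub_left ?_ 1
    have hNpos : (0 : ℝ) < Nat.card (TClass Δ n) := by exact_mod_cast hpos n (by omega)
    have h3 : ((trees Δ n).card : ℝ) ≤ n * Nat.card (TClass Δ n) := by
      exact_mod_cast card_trees_le Δ n
    have h4 : (Nat.card {c : TClass Δ n // ¬ |randic β (Quotient.out c).1 - r * n| ≤ ε * n} : ℝ)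
        ≤ _ := Nat.cast_le.2 (card_bad_le (r := r) (by omega) hn h1)
    have h5 := (mul_le_mul_of_nonneg_right h4
      (by positivity : 0 ≤ ρ ^ n * Real.exp (a * n))).trans (hC n)
    have hC0 : 0 ≤ C := le_trans (by positivity) h5
    rw [div_le_iff₀ hNpos]
    have h6 : 1 ≤ n * Nat.card (TClass Δ n) * ρ ^ n * Real.exp (a / 2 * n) := by
      calc (1 : ℝ) = Real.exp (-(a / 2 * n)) * Real.exp (a / 2 * n) := by
            rw [← Real.exp_add]; simp
        _ ≤ (trees Δ n).card * ρ ^ n * Real.exp (a / 2 * n) := by gcongr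
        _ ≤ _ := by gcongr
    rw [← Real.exp_nat_mul]
    have h7 : Real.exp (n * -(a / 2)) = Real.exp (a / 2 * n) * Real.exp (-(a * n)) := by
      rw [← Real.exp_add]; ring_nf
    have h8 := mul_le_mul_of_nonneg_right h5
      (by positivity : 0 ≤ (ρ ^ n)⁻¹ * Real.exp (-(a * n)))
    have h9 : Real.exp (a * n) * Real.exp (-(a * n)) = 1 := by rw [← Real.exp_add]; simp
    have h10 : ρ ^ n * (ρ ^ n)⁻¹ = 1 := mul_inv_cancel₀ (by positivity)
    calc _ = Nat.card {c : TClass Δ n // ¬ |randic β (Quotient.out c).1 - r * n| ≤ ε * n}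
            * (ρ ^ n * Real.exp (a * n)) * ((ρ ^ n)⁻¹ * Real.exp (-(a * n))) := by
          rw [mul_assoc, mul_mul_mul_comm, h9, h10, mul_one, mul_one]
      _ ≤ C * ((ρ ^ n)⁻¹ * Real.exp (-(a * n))) := h8
      _ ≤ C * ((ρ ^ n)⁻¹ * Real.exp (-(a * n)))
            * (n * Nat.card (TClass Δ n) * ρ ^ n * Real.exp (a / 2 * n)) :=
          le_mul_of_one_le_right (by positivity) h6
      _ = _ := by rw [h7]; field_simp
  · filter_upwards [eventually_ge_atTop 1] with n hn
    rw [prob_eq_one_sub (hpos n hn)]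
    linarith [show (0 : ℝ) ≤ Nat.card {c : TClass Δ n //
      ¬ |randic β (Quotient.out c).1 - r * n| ≤ ε * n} / Nat.card (TClass Δ n) by positivity]

end TreePaper
end

section
/- Let T be a finite tree (a connected acyclic simple graph) with at least one vertex, and let Aut(T) be its automorphism group. Call two vertices similar if some automorphism maps one to the other, and likewise for edges; call an edge {u,v} symmetric if some automorphism of T exchanges u and v. Then the number of similarity classes of vertices of T equals 1 plus the number of similarity classes of edges of T that are not symmetric. Equivalently: (number of Aut(T)-orbits on vertices) − (number of Aut(T)-orbits on non-symmetric edges) = 1. -/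
namespace TreePaper

variable {V : Type} [Fintype V]

/-- Two vertices are similar if some automorphism maps one to the other. -/
def vertexSetoid (G : SimpleGraph V) : Setoid V where
  r u v := ∃ φ : G ≃g G, φ u = v
  iseqv := by
    refine ⟨fun u => ⟨SimpleGraph.Iso.refl, rfl⟩, ?_, ?_⟩
    · rintro u v ⟨φ, rfl⟩
      exact ⟨φ.symm, φ.symm_apply_apply u⟩
    · rintro u v w ⟨φ, rfl⟩ ⟨ψ, rfl⟩
      exact ⟨φ.trans ψ, rfl⟩

/-- An edge `{u,v}` is symmetric if some automorphism exchanges `u` and `v`. -/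
def IsSymmetricEdge (G : SimpleGraph V) (e : Sym2 V) : Prop :=
  ∃ (u v : V) (φ : G ≃g G), e = s(u, v) ∧ φ u = v ∧ φ v = u

/-- Two non-symmetric edges are similar if some automorphism maps one to the other. -/
def edgeSetoid (G : SimpleGraph V) :
    Setoid {e : G.edgeSet // ¬ IsSymmetricEdge G (e : Sym2 V)} where
  r e f := ∃ φ : G ≃g G, Sym2.map φ (e.1 : Sym2 V) = (f.1 : Sym2 V)
  iseqv := by
    refine ⟨fun e => ⟨SimpleGraph.Iso.refl, ?_⟩, ?_, ?_⟩
    · simp [Sym2.map_id]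
    · rintro e f ⟨φ, h⟩
      refine ⟨φ.symm, ?_⟩
      rw [← h, Sym2.map_map]
      have hcomp : (⇑φ.symm ∘ ⇑φ) = id := by ext x; simp
      rw [hcomp, Sym2.map_id, id]
    · rintro e f g ⟨φ, h₁⟩ ⟨ψ, h₂⟩
      refine ⟨φ.trans ψ, ?_⟩
      rw [← h₂, ← h₁, Sym2.map_map]
      rfl

section Orientation

variable {W : Type}

/-- The vertices strictly closer to `v` than to `u`. If `u` and `v` are adjacent vertices of a tree,
this is the component of `v` after removal of the edge `{u,v}`. -/
def branch (G : SimpleGraph W) (u v : W) : Set W :=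
  {w | G.dist v w < G.dist u w}

theorem dist_map_le {G : SimpleGraph W} (hG : G.Connected) (φ : G ≃g G) (u v : W) :
    G.dist (φ u) (φ v) ≤ G.dist u v := by
  obtain ⟨p, hp⟩ := hG.exists_walk_length_eq_dist u v
  rw [← hp, ← SimpleGraph.Walk.length_map φ.toHom p]
  exact SimpleGraph.dist_le _

theorem dist_map {G : SimpleGraph W} (hG : G.Connected) (φ : G ≃g G) (u v : W) :
    G.dist (φ u) (φ v) = G.dist u v := by
  refine le_antisymm (dist_map_le hG φ u v) ?_
  simpa using dist_map_le hG φ.symm (φ u) (φ v)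

theorem ncard_branch_map {G : SimpleGraph W} (hG : G.Connected) (φ : G ≃g G) (u v : W) :
    (branch G (φ u) (φ v)).ncard = (branch G u v).ncard := by
  rw [← Set.ncard_image_of_injective (branch G u v) φ.injective]
  congr 1
  ext w
  obtain ⟨w, rfl⟩ := φ.surjective w
  simp [branch, dist_map hG]

theorem ncard_branch_add [Finite W] {G : SimpleGraph W} (hG : G.IsTree) {u v : W}
    (h : G.Adj u v) : (branch G u v).ncard + (branch G v u).ncard = Nat.card W := by
  have hcompl : branch G v u = (branch G u v)ᶜ := by
    ext w
    have hne := hG.dist_ne_of_adj w h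
    rw [G.dist_comm (u := w), G.dist_comm (u := w)] at hne
    simp only [branch, Set.mem_ofPred_eq, Set.mem_compl_iff]
    omega
  rw [hcompl, Set.ncard_add_ncard_compl]

theorem eq_of_mem_branch {G : SimpleGraph W} (hG : G.IsTree) {u v w x : W} (hv : G.Adj u v)
    (hw : G.Adj u w) (hxv : x ∈ branch G u v) (hxw : x ∈ branch G u w) : v = w := by
  have key : ∀ {z : W} (h : G.Adj u z), x ∈ branch G u z →
      ∃ p : G.Walk z x, (SimpleGraph.Walk.cons h p).IsPath := by
    intro z h hx
    obtain ⟨p, hp⟩ := hG.connected.exists_walk_length_eq_dist z x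
    refine ⟨p, SimpleGraph.Walk.isPath_of_length_eq_dist _ ?_⟩
    have hle := SimpleGraph.dist_le (SimpleGraph.Walk.cons h p)
    have hlt : G.dist z x < G.dist u x := hx
    simp only [SimpleGraph.Walk.length_cons] at hle ⊢
    omega
  obtain ⟨p, hp⟩ := key hv hxv
  obtain ⟨q, hq⟩ := key hw hxw
  have h := congrArg Subtype.val
    ((hG.isAcyclic.subsingleton_path u x).elim ⟨_, hp⟩ ⟨_, hq⟩)
  simpa using congrArg SimpleGraph.Walk.snd h

theorem eq_of_card_le_two_mul_ncard_branch [Finite W] {G : SimpleGraph W} (hG : G.IsTree)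
    {u v w : W} (hv : G.Adj u v) (hw : G.Adj u w) (hcv : Nat.card W ≤ 2 * (branch G u v).ncard)
    (hcw : Nat.card W ≤ 2 * (branch G u w).ncard) : v = w := by
  by_contra hne
  have hdisj : Disjoint (branch G u v) (branch G u w) :=
    Set.disjoint_left.2 fun x hxv hxw => hne (eq_of_mem_branch hG hv hw hxv hxw)
  have hlt : (branch G u v ∪ branch G u w).ncard < Nat.card W :=
    Set.ncard_lt_card fun h => by simpa [branch] using h.ge (Set.mem_univ u)
  rw [Set.ncard_union_eq hdisj] at hlt
  omega

/-- An automorphism-invariant choice of a direction or of both directions for every edge,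
with at most one edge leaving each vertex, in which both directions are chosen only for
symmetric edges. -/
structure IsInvariantOrientation (G : SimpleGraph W) (R : W → W → Prop) : Prop where
  adj : ∀ {u v}, R u v → G.Adj u v
  total : ∀ {u v}, G.Adj u v → R u v ∨ R v u
  unique : ∀ {u v w}, R u v → R u w → v = w
  map : ∀ (φ : G ≃g G) {u v}, R u v → R (φ u) (φ v)
  swap : ∀ {u v}, R u v → R v u → ∃ φ : G ≃g G, φ u = v ∧ φ v = u

/-- Orient the edges of a finite tree towards the larger branch; a tie between similar vertices
keeps both directions, other ties are broken by a linear order on the similarity classes. -/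
theorem exists_isInvariantOrientation [Finite W] {G : SimpleGraph W} (hG : G.IsTree) :
    ∃ R, IsInvariantOrientation G R := by
  obtain ⟨n, ⟨c⟩⟩ := Finite.exists_equiv_fin (Quotient (vertexSetoid G))
  have hc : ∀ (φ : G ≃g G) u, c (Quotient.mk (vertexSetoid G) (φ u)) = c (Quotient.mk _ u) :=
    fun φ u => congrArg c (Quotient.sound ⟨φ.symm, by simp⟩)
  refine ⟨fun u v => G.Adj u v ∧ Nat.card W ≤ 2 * (branch G u v).ncard ∧
    (Nat.card W ≤ 2 * (branch G v u).ncard →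
      c (Quotient.mk (vertexSetoid G) u) ≤ c (Quotient.mk _ v)), ⟨?_, ?_, ?_, ?_, ?_⟩⟩
  · exact fun h => h.1
  · intro u v h
    have hadd := ncard_branch_add hG h
    have htot := le_total (c (Quotient.mk (vertexSetoid G) u)) (c (Quotient.mk _ v))
    have hsymm := h.symm
    by_cases h₁ : Nat.card W ≤ 2 * (branch G u v).ncard <;>
      by_cases h₂ : Nat.card W ≤ 2 * (branch G v u).ncard
    · tauto
    · tauto
    · tauto
    · omega
  · exact fun hv hw => eq_of_card_le_two_mul_ncard_branch hG hv.1 hw.1 hv.2.1 hw.2.1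
  · rintro φ u v ⟨h, hcard, hle⟩
    simp only [ncard_branch_map hG.connected, hc]
    exact ⟨φ.map_adj_iff.2 h, hcard, hle⟩
  · rintro u v ⟨h, huv, hle⟩ ⟨-, hvu, hge⟩
    obtain ⟨φ, rfl⟩ := Quotient.exact (c.injective (le_antisymm (hle hvu) (hge huv)))
    refine ⟨φ, rfl, ?_⟩
    refine eq_of_card_le_two_mul_ncard_branch hG (φ.map_adj_iff.2 h) h.symm ?_ hvu
    rwa [ncard_branch_map hG.connected]

/-- A vertex which no nonsymmetric edge leaves. -/
def IsTerminal (R : W → W → Prop) (u : W) : Prop :=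
  ∀ v, R u v → R v u

namespace IsInvariantOrientation

variable {G : SimpleGraph W} {R : W → W → Prop}

theorem isSymmetricEdge_iff (hR : IsInvariantOrientation G R) {u v : W} (h : R u v) :
    IsSymmetricEdge G s(u, v) ↔ R v u := by
  constructor
  · rintro ⟨x, y, φ, he, hx, hy⟩
    have hmap := hR.map φ h
    rcases Sym2.eq_iff.1 he with ⟨rfl, rfl⟩ | ⟨rfl, rfl⟩ <;> rwa [hx, hy] at hmap
  · intro h'
    obtain ⟨φ, hu, hv⟩ := hR.swap h h'
    exact ⟨u, v, φ, rfl, hu, hv⟩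

theorem exists_isTerminal [Finite W] (hG : G.IsTree) (hR : IsInvariantOrientation G R) :
    ∃ u, IsTerminal R u := by
  by_contra! h
  simp only [IsTerminal, not_forall] at h
  choose f hf hf' using h
  have hinj : Function.Injective fun u => (⟨s(u, f u), hR.adj (hf u)⟩ : G.edgeSet) := by
    intro u v huv
    rcases Sym2.eq_iff.1 (congrArg Subtype.val huv) with ⟨h, -⟩ | ⟨h₁, h₂⟩
    · exact h
    · exact absurd (h₂ ▸ h₁ ▸ hf v) (hf' u)
  have hle : Nat.card W ≤ Nat.card G.edgeSet := Nat.card_le_card_of_injective _ hinj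
  have hcard := (SimpleGraph.isTree_iff_connected_and_card.1 hG).2
  omega

theorem similar_of_isTerminal [Finite W] (hG : G.IsTree) (hR : IsInvariantOrientation G R)
    {x y : W} (hx : IsTerminal R x) (hy : IsTerminal R y) : vertexSetoid G x y := by
  by_contra hxy
  have htail : ∀ e : G.edgeSet, ∃ u v, (e : Sym2 W) = s(u, v) ∧ R u v ∧ u ≠ x ∧ u ≠ y := by
    have key : ∀ u v, R u v →
        ∃ u' v', s(u, v) = s(u', v') ∧ R u' v' ∧ u' ≠ x ∧ u' ≠ y := by
      intro u v h
      by_cases hu : u ≠ x ∧ u ≠ y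
      · exact ⟨u, v, rfl, h, hu⟩
      have hvu : R v u := by
        rcases not_and_or.1 hu with hu | hu
        · exact (not_not.1 hu ▸ hx) v h
        · exact (not_not.1 hu ▸ hy) v h
      obtain ⟨φ, hφu, hφv⟩ := hR.swap h hvu
      have hne := (hR.adj h).ne
      refine ⟨v, u, Sym2.eq_swap, hvu, ?_, ?_⟩
      · rintro rfl
        obtain rfl : u = y := by tauto
        exact hxy ⟨φ, hφv⟩
      · rintro rfl
        obtain rfl : u = x := by tauto
        exact hxy ⟨φ, hφu⟩
    rintro ⟨e, he⟩
    induction e with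
    | _ u v =>
      rcases hR.total he with h | h
      · exact key u v h
      · simpa only [Sym2.eq_swap] using key v u h
  choose t w he hR' htx hty using htail
  have hinj : Function.Injective fun e => (⟨t e, by simp [htx e, hty e]⟩ : ({x, y}ᶜ : Set W)) := by
    intro e f h
    have ht : t e = t f := congrArg Subtype.val h
    have hw : w e = w f := hR.unique (hR' e) (ht ▸ hR' f)
    exact Subtype.ext (by rw [he e, he f, ht, hw])
  have hle : Nat.card G.edgeSet ≤ Nat.card ({x, y}ᶜ : Set W) :=
    Nat.card_le_card_of_injective _ hinj
  have hcard := (SimpleGraph.isTree_iff_connected_and_card.1 hG).2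
  have hne : x ≠ y := fun h => hxy (h ▸ (vertexSetoid G).refl x)
  have hcompl := Set.ncard_add_ncard_compl ({x, y} : Set W)
  rw [Set.ncard_pair hne] at hcompl
  rw [Nat.card_coe_set_eq ({x, y}ᶜ)] at hle
  omega

theorem isTerminal_map (hR : IsInvariantOrientation G R) {u : W} (hu : IsTerminal R u)
    (φ : G ≃g G) : IsTerminal R (φ u) := by
  intro v h
  have h' := hR.map φ.symm h
  rw [φ.symm_apply_apply] at h'
  simpa using hR.map φ (hu _ h')

theorem exists_tail (hR : IsInvariantOrientation G R)
    (e : {e : G.edgeSet // ¬ IsSymmetricEdge G (e : Sym2 W)}) :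
    ∃ u v, (e.1 : Sym2 W) = s(u, v) ∧ R u v ∧ ¬ R v u := by
  obtain ⟨⟨e, he⟩, hs⟩ := e
  induction e with
  | _ u v =>
    rcases hR.total he with h | h
    · exact ⟨u, v, rfl, h, (hR.isSymmetricEdge_iff h).not.1 hs⟩
    · refine ⟨v, u, Sym2.eq_swap, h, (hR.isSymmetricEdge_iff h).not.1 ?_⟩
      rwa [Sym2.eq_swap]

end IsInvariantOrientation

end Orientation

/-- Otter's dissimilarity characteristic for a single tree.
For a finite nonempty tree `T`, the number of similarity classes of vertices equals
`1` plus the number of similarity classes of non-symmetric edges. -/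
theorem otter_dissimilarity [Nonempty V] (G : SimpleGraph V) (hG : G.IsTree) :
    Nat.card (Quotient (vertexSetoid G)) =
      Nat.card (Quotient (edgeSetoid G)) + 1 := by
  obtain ⟨R, hR⟩ := exists_isInvariantOrientation hG
  obtain ⟨r, hr⟩ := hR.exists_isTerminal hG
  choose t w he hR' hR'' using hR.exists_tail
  let f : Option (Quotient (edgeSetoid G)) → Quotient (vertexSetoid G) := fun o =>
    o.elim (Quotient.mk _ r) fun q => Quotient.mk _ (t q.out)
  have hr' : ∀ e, ¬ vertexSetoid G r (t e) := by
    rintro e ⟨φ, h⟩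
    exact hR'' e (h ▸ hR.isTerminal_map hr φ (w e) (h ▸ hR' e))
  have hf : Function.Bijective f := by
    constructor
    · rintro (_ | p) (_ | q) h
      · rfl
      · exact (hr' _ (Quotient.exact h)).elim
      · exact (hr' _ (Quotient.exact h.symm)).elim
      · obtain ⟨φ, h⟩ := Quotient.exact h
        have hw : φ (w p.out) = w q.out :=
          hR.unique (h ▸ hR.map φ (hR' p.out)) (hR' q.out)
        rw [← p.out_eq, ← q.out_eq]
        refine congrArg some (Quotient.sound ⟨φ, ?_⟩)
        rw [he, he, Sym2.map_mk, h, hw]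
    · rintro ⟨x⟩
      by_cases hx : IsTerminal R x
      · exact ⟨none, Quotient.sound (hR.similar_of_isTerminal hG hr hx)⟩
      simp only [IsTerminal, not_forall] at hx
      obtain ⟨v, hxv, hvx⟩ := hx
      let e : {e : G.edgeSet // ¬ IsSymmetricEdge G (e : Sym2 V)} :=
        ⟨⟨s(x, v), hR.adj hxv⟩, (hR.isSymmetricEdge_iff hxv).not.2 hvx⟩
      refine ⟨some (Quotient.mk _ e), Quotient.sound ?_⟩
      obtain ⟨φ, h⟩ := (edgeSetoid G).trans (Quotient.mk_out e) ((edgeSetoid G).refl e)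
      rw [he, Sym2.map_mk] at h
      rcases Sym2.eq_iff.1 h with ⟨h, -⟩ | ⟨h₁, h₂⟩
      · exact ⟨φ, h⟩
      · exact absurd (h₁ ▸ h₂ ▸ hR.map φ (hR' _)) hvx
  rw [← Nat.card_congr (Equiv.ofBijective f hf), Finite.card_option]

end TreePaper
end
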